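/- arXiv:2601.01447 — 8 statements merged into one kernel-verified Lean document; each statement's English description precedes it below -/
import Mathlib

section
/- Let u₀ > 0 and let X_{γ,u₀} be the space of continuous functions g on [u₀,∞) with ‖g‖_{γ,u₀} := sup_{x ≥ u₀} x^γ |g(x)| < ∞. For g ∈ X_{γ,u₀} define T g(u) := μ u^{−γ} e^{−α/u} ∫_u^∞ t^{γ−2} e^{α/t} (∫₀^∞ g(t+z) F̄(z) dz) dt. Then T g is well defined and continuous on [u₀,∞), ‖T g‖_{γ,u₀} ≤ (μ m / u₀) ‖g‖_{γ,u₀}, and for any g₁, g₂ ∈ X_{γ,u₀}, ‖T g₁ − T g₂‖_{γ,u₀} ≤ (μ m / u₀) ‖g₁ − g₂‖_{γ,u₀}. In particular, if u₀ > μ m, then T is a contraction of the Banach space X_{γ,u₀}. -/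
open MeasureTheory Set Filter Topology

/-- The weighted sup-norm `‖g‖_{γ,u₀} = sup_{x ≥ u₀} x^γ |g(x)|`. -/
noncomputable def pnorm (p u₀ : ℝ) (g : ℝ → ℝ) : ℝ :=
  ⨆ x : {x : ℝ // u₀ ≤ x}, (x : ℝ) ^ p * |g x|

/-- The operator `T g (u) = μ u^{-γ} e^{-α/u} ∫_u^∞ t^{γ-2} e^{α/t} (∫₀^∞ g(t+z) F̄(z) dz) dt`. -/
noncomputable def opT (μ α γ : ℝ) (Fbar g : ℝ → ℝ) (u : ℝ) : ℝ :=
  μ * u ^ (-γ) * Real.exp (-(α / u)) *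
    ∫ t in Set.Ioi u, t ^ (γ - 2) * Real.exp (α / t) *
      ∫ z in Set.Ioi (0 : ℝ), g (t + z) * Fbar z

lemma rpow_abs_le_pnorm {p u₀ : ℝ} {g : ℝ → ℝ}
    (hgb : BddAbove (Set.range fun x : {x : ℝ // u₀ ≤ x} => (x : ℝ) ^ p * |g x|))
    {x : ℝ} (hx : u₀ ≤ x) : x ^ p * |g x| ≤ pnorm p u₀ g :=
  le_ciSup hgb ⟨x, hx⟩

lemma pnorm_le {p u₀ C : ℝ} {g : ℝ → ℝ} (h : ∀ x, u₀ ≤ x → x ^ p * |g x| ≤ C) :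
    pnorm p u₀ g ≤ C :=
  have : Nonempty {x : ℝ // u₀ ≤ x} := ⟨⟨u₀, le_rfl⟩⟩
  ciSup_le fun x => h x x.2

section WeightedBound

variable {Fbar g : ℝ → ℝ} {α γ u₀ M : ℝ}

lemma abs_shift_mul_le (hγ : 0 < γ) (hF_nonneg : ∀ z ∈ Ioi (0 : ℝ), 0 ≤ Fbar z) (hu₀ : 0 < u₀)
    (hM : ∀ x, u₀ ≤ x → x ^ γ * |g x| ≤ M) {t z : ℝ} (ht : u₀ ≤ t) (hz : 0 < z) :
    ‖g (t + z) * Fbar z‖ ≤ M * t ^ (-γ) * Fbar z := by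
  have ht0 : 0 < t := hu₀.trans_le ht
  rw [norm_mul, Real.norm_eq_abs, Real.norm_of_nonneg (hF_nonneg z hz), Real.rpow_neg ht0.le]
  refine mul_le_mul_of_nonneg_right ?_ (hF_nonneg z hz)
  rw [← div_eq_mul_inv, le_div_iff₀' (Real.rpow_pos_of_pos ht0 γ)]
  refine le_trans ?_ (hM (t + z) (by linarith))
  gcongr
  linarith

lemma aestronglyMeasurable_shift_mul (hF_int : IntegrableOn Fbar (Ioi 0))
    (hg : ContinuousOn g (Ici u₀)) {t : ℝ} (ht : u₀ ≤ t) :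
    AEStronglyMeasurable (fun z => g (t + z) * Fbar z) (volume.restrict (Ioi 0)) := by
  refine AEStronglyMeasurable.mul ?_ hF_int.aestronglyMeasurable
  refine ContinuousOn.aestronglyMeasurable ?_ measurableSet_Ioi
  exact hg.comp (by fun_prop) fun z (hz : 0 < z) => show u₀ ≤ t + z by linarith

lemma integrableOn_shift_mul (hγ : 0 < γ) (hF_nonneg : ∀ z ∈ Ioi (0 : ℝ), 0 ≤ Fbar z)
    (hF_int : IntegrableOn Fbar (Ioi 0)) (hu₀ : 0 < u₀) (hg : ContinuousOn g (Ici u₀))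
    (hM : ∀ x, u₀ ≤ x → x ^ γ * |g x| ≤ M) {t : ℝ} (ht : u₀ ≤ t) :
    IntegrableOn (fun z => g (t + z) * Fbar z) (Ioi 0) :=
  (hF_int.const_mul (M * t ^ (-γ))).mono' (aestronglyMeasurable_shift_mul hF_int hg ht) <|
    ae_restrict_of_forall_mem measurableSet_Ioi fun _ hz =>
      abs_shift_mul_le hγ hF_nonneg hu₀ hM ht hz

lemma abs_integral_shift_mul_le (hγ : 0 < γ) (hF_nonneg : ∀ z ∈ Ioi (0 : ℝ), 0 ≤ Fbar z)
    (hF_int : IntegrableOn Fbar (Ioi 0)) (hu₀ : 0 < u₀)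
    (hM : ∀ x, u₀ ≤ x → x ^ γ * |g x| ≤ M) {t : ℝ} (ht : u₀ ≤ t) :
    ‖∫ z in Ioi (0 : ℝ), g (t + z) * Fbar z‖ ≤ M * t ^ (-γ) * ∫ z in Ioi (0 : ℝ), Fbar z := by
  rw [← integral_const_mul]
  exact norm_integral_le_of_norm_le (hF_int.const_mul _) <|
    ae_restrict_of_forall_mem measurableSet_Ioi fun _ hz =>
      abs_shift_mul_le hγ hF_nonneg hu₀ hM ht hz

lemma continuousOn_integral_shift_mul (hγ : 0 < γ) (hF_nonneg : ∀ z ∈ Ioi (0 : ℝ), 0 ≤ Fbar z)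
    (hF_int : IntegrableOn Fbar (Ioi 0)) (hu₀ : 0 < u₀) (hg : ContinuousOn g (Ici u₀))
    (hM : ∀ x, u₀ ≤ x → x ^ γ * |g x| ≤ M) :
    ContinuousOn (fun t => ∫ z in Ioi (0 : ℝ), g (t + z) * Fbar z) (Ici u₀) := by
  have hM0 : 0 ≤ M :=
    (mul_nonneg (Real.rpow_nonneg hu₀.le _) (abs_nonneg _)).trans (hM u₀ le_rfl)
  refine continuousOn_of_dominated (bound := fun z => M * u₀ ^ (-γ) * Fbar z)
    (fun t ht => aestronglyMeasurable_shift_mul hF_int hg ht) (fun t ht => ?_)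
    (hF_int.const_mul _) ?_
  · refine ae_restrict_of_forall_mem measurableSet_Ioi fun z hz =>
      (abs_shift_mul_le hγ hF_nonneg hu₀ hM ht hz).trans ?_
    refine mul_le_mul_of_nonneg_right ?_ (hF_nonneg z hz)
    exact mul_le_mul_of_nonneg_left
      (Real.rpow_le_rpow_of_nonpos hu₀ ht (neg_nonpos.2 hγ.le)) hM0
  · refine ae_restrict_of_forall_mem measurableSet_Ioi fun z hz => ?_
    refine ContinuousOn.mul (hg.comp (by fun_prop) fun t ht => ?_) continuousOn_const
    exact le_add_of_le_of_nonneg ht (mem_Ioi.1 hz).le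

lemma abs_opT_integrand_le (hα : 0 < α) (hγ : 0 < γ)
    (hF_nonneg : ∀ z ∈ Ioi (0 : ℝ), 0 ≤ Fbar z) (hF_int : IntegrableOn Fbar (Ioi 0))
    (hu₀ : 0 < u₀) (hM : ∀ x, u₀ ≤ x → x ^ γ * |g x| ≤ M) {u t : ℝ} (hu : u₀ ≤ u) (ht : u < t) :
    ‖t ^ (γ - 2) * Real.exp (α / t) * ∫ z in Ioi (0 : ℝ), g (t + z) * Fbar z‖ ≤
      Real.exp (α / u) * (M * ∫ z in Ioi (0 : ℝ), Fbar z) * t ^ (-2 : ℝ) := by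
  have hM0 : 0 ≤ M :=
    (mul_nonneg (Real.rpow_nonneg hu₀.le _) (abs_nonneg _)).trans (hM u₀ le_rfl)
  have hu0 : 0 < u := hu₀.trans_le hu
  have ht0 : 0 < t := hu0.trans ht
  have hm0 : 0 ≤ ∫ z in Ioi (0 : ℝ), Fbar z := setIntegral_nonneg measurableSet_Ioi hF_nonneg
  have hpow : t ^ (-2 : ℝ) = t ^ (γ - 2) * t ^ (-γ) := by
    rw [← Real.rpow_add ht0]; congr 1; ring
  have hexp : Real.exp (α / t) ≤ Real.exp (α / u) := by gcongr
  rw [norm_mul, Real.norm_of_nonneg (by positivity), hpow]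
  calc _ ≤ t ^ (γ - 2) * Real.exp (α / u) * (M * t ^ (-γ) * ∫ z in Ioi (0 : ℝ), Fbar z) := by
        gcongr
        exact abs_integral_shift_mul_le hγ hF_nonneg hF_int hu₀ hM (hu.trans ht.le)
    _ = _ := by ring

lemma integrableOn_opT_integrand (hα : 0 < α) (hγ : 0 < γ)
    (hF_nonneg : ∀ z ∈ Ioi (0 : ℝ), 0 ≤ Fbar z) (hF_int : IntegrableOn Fbar (Ioi 0))
    (hu₀ : 0 < u₀) (hg : ContinuousOn g (Ici u₀)) (hM : ∀ x, u₀ ≤ x → x ^ γ * |g x| ≤ M)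
    {u : ℝ} (hu : u₀ ≤ u) :
    IntegrableOn
      (fun t => t ^ (γ - 2) * Real.exp (α / t) * ∫ z in Ioi (0 : ℝ), g (t + z) * Fbar z)
      (Ioi u) := by
  have hne : ∀ t ∈ Ioi u, t ≠ 0 := fun t ht => (hu₀.trans_le hu |>.trans ht).ne'
  refine Integrable.mono' ((integrableOn_Ioi_rpow_of_lt (by norm_num : (-2 : ℝ) < -1)
    (hu₀.trans_le hu)).const_mul (Real.exp (α / u) * (M * ∫ z in Ioi (0 : ℝ), Fbar z)))
    (ContinuousOn.aestronglyMeasurable ?_ measurableSet_Ioi)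
    (ae_restrict_of_forall_mem measurableSet_Ioi fun t ht =>
      abs_opT_integrand_le hα hγ hF_nonneg hF_int hu₀ hM hu ht)
  refine ContinuousOn.mul (ContinuousOn.mul ?_ ?_) ?_
  · exact continuousOn_id.rpow_const fun t ht => Or.inl (hne t ht)
  · exact (continuousOn_const.div continuousOn_id hne).rexp
  · exact (continuousOn_integral_shift_mul hγ hF_nonneg hF_int hu₀ hg hM).mono
      (Ioi_subset_Ici hu)

lemma continuousOn_opT (μ : ℝ) (hα : 0 < α) (hγ : 0 < γ)
    (hF_nonneg : ∀ z ∈ Ioi (0 : ℝ), 0 ≤ Fbar z) (hF_int : IntegrableOn Fbar (Ioi 0))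
    (hu₀ : 0 < u₀) (hg : ContinuousOn g (Ici u₀)) (hM : ∀ x, u₀ ≤ x → x ^ γ * |g x| ≤ M) :
    ContinuousOn (opT μ α γ Fbar g) (Ici u₀) := by
  have hne : ∀ t ∈ Ici u₀, t ≠ 0 := fun t ht => (hu₀.trans_le ht).ne'
  refine ContinuousOn.mul (ContinuousOn.mul (continuousOn_const.mul ?_) ?_) ?_
  · exact continuousOn_id.rpow_const fun t ht => Or.inl (hne t ht)
  · exact (continuousOn_const.div continuousOn_id hne).neg.rexp
  · exact IntegrableOn.continuousOn_Ici_primitive_Ioi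
      (integrableOn_opT_integrand hα hγ hF_nonneg hF_int hu₀ hg hM le_rfl)

lemma rpow_abs_opT_le {μ : ℝ} (hμ : 0 < μ) (hα : 0 < α) (hγ : 0 < γ)
    (hF_nonneg : ∀ z ∈ Ioi (0 : ℝ), 0 ≤ Fbar z) (hF_int : IntegrableOn Fbar (Ioi 0))
    (hu₀ : 0 < u₀) (hM : ∀ x, u₀ ≤ x → x ^ γ * |g x| ≤ M) {u : ℝ} (hu : u₀ ≤ u) :
    u ^ γ * |opT μ α γ Fbar g u| ≤ μ * (∫ z in Ioi (0 : ℝ), Fbar z) / u₀ * M := by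
  have hM0 : 0 ≤ M :=
    (mul_nonneg (Real.rpow_nonneg hu₀.le _) (abs_nonneg _)).trans (hM u₀ le_rfl)
  have hu0 : 0 < u := hu₀.trans_le hu
  have hm0 : 0 ≤ ∫ z in Ioi (0 : ℝ), Fbar z := setIntegral_nonneg measurableSet_Ioi hF_nonneg
  have hint : ‖∫ t in Ioi u, t ^ (γ - 2) * Real.exp (α / t) *
      ∫ z in Ioi (0 : ℝ), g (t + z) * Fbar z‖ ≤
      Real.exp (α / u) * (M * ∫ z in Ioi (0 : ℝ), Fbar z) * u⁻¹ := by
    have htail : ∫ t in Ioi u, t ^ (-2 : ℝ) = u⁻¹ := by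
      rw [integral_Ioi_rpow_of_lt (by norm_num) hu0]
      norm_num [Real.rpow_neg_one]
    rw [← htail, ← integral_const_mul]
    exact norm_integral_le_of_norm_le
      ((integrableOn_Ioi_rpow_of_lt (by norm_num) hu0).const_mul _)
      (ae_restrict_of_forall_mem measurableSet_Ioi fun t ht =>
        abs_opT_integrand_le hα hγ hF_nonneg hF_int hu₀ hM hu ht)
  rw [opT, abs_mul, abs_of_nonneg (by positivity), ← Real.norm_eq_abs]
  have hpow : u ^ γ * u ^ (-γ) = 1 := by rw [← Real.rpow_add hu0]; simp
  have hexp : Real.exp (-(α / u)) * Real.exp (α / u) = 1 := by rw [← Real.exp_add]; simp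
  calc _ ≤ u ^ γ * (μ * u ^ (-γ) * Real.exp (-(α / u)) *
        (Real.exp (α / u) * (M * ∫ z in Ioi (0 : ℝ), Fbar z) * u⁻¹)) := by gcongr
    _ = (u ^ γ * u ^ (-γ)) * (Real.exp (-(α / u)) * Real.exp (α / u)) *
        (μ * (∫ z in Ioi (0 : ℝ), Fbar z) / u * M) := by ring
    _ = μ * (∫ z in Ioi (0 : ℝ), Fbar z) / u * M := by rw [hpow, hexp]; ring
    _ ≤ _ := by gcongr

end WeightedBound

lemma opT_sub {Fbar g₁ g₂ : ℝ → ℝ} {α γ u₀ M₁ M₂ : ℝ} (μ : ℝ) (hα : 0 < α) (hγ : 0 < γ)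
    (hF_nonneg : ∀ z ∈ Ioi (0 : ℝ), 0 ≤ Fbar z) (hF_int : IntegrableOn Fbar (Ioi 0))
    (hu₀ : 0 < u₀) (hg₁ : ContinuousOn g₁ (Ici u₀)) (hM₁ : ∀ x, u₀ ≤ x → x ^ γ * |g₁ x| ≤ M₁)
    (hg₂ : ContinuousOn g₂ (Ici u₀)) (hM₂ : ∀ x, u₀ ≤ x → x ^ γ * |g₂ x| ≤ M₂)
    {u : ℝ} (hu : u₀ ≤ u) :
    opT μ α γ Fbar (fun x => g₁ x - g₂ x) u = opT μ α γ Fbar g₁ u - opT μ α γ Fbar g₂ u := by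
  rw [opT, opT, opT, ← mul_sub, ← integral_sub
    (integrableOn_opT_integrand hα hγ hF_nonneg hF_int hu₀ hg₁ hM₁ hu)
    (integrableOn_opT_integrand hα hγ hF_nonneg hF_int hu₀ hg₂ hM₂ hu)]
  congr 1
  refine setIntegral_congr_fun measurableSet_Ioi fun t ht => ?_
  have ht' : u₀ ≤ t := hu.trans (le_of_lt ht)
  simp only [sub_mul]
  rw [integral_sub (integrableOn_shift_mul hγ hF_nonneg hF_int hu₀ hg₁ hM₁ ht')
    (integrableOn_shift_mul hγ hF_nonneg hF_int hu₀ hg₂ hM₂ ht'), mul_sub]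

theorem stmt2
    (Fbar : ℝ → ℝ) (μ α γ m : ℝ)
    (hμ : 0 < μ) (hα : 0 < α) (hγ : 0 < γ)
    (hF_anti : AntitoneOn Fbar (Set.Ici 0))
    (hF_mem : ∀ y ∈ Set.Ici (0 : ℝ), Fbar y ∈ Set.Icc (0 : ℝ) 1)
    (hF_int : IntegrableOn Fbar (Set.Ioi 0))
    (hm : m = ∫ z in Set.Ioi (0 : ℝ), Fbar z)
    (u₀ : ℝ) (hu₀ : 0 < u₀)
    (g g₁ g₂ : ℝ → ℝ)
    (hg : ContinuousOn g (Set.Ici u₀))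
    (hgb : BddAbove (Set.range fun x : {x : ℝ // u₀ ≤ x} => (x : ℝ) ^ γ * |g x|))
    (hg₁ : ContinuousOn g₁ (Set.Ici u₀))
    (hg₁b : BddAbove (Set.range fun x : {x : ℝ // u₀ ≤ x} => (x : ℝ) ^ γ * |g₁ x|))
    (hg₂ : ContinuousOn g₂ (Set.Ici u₀))
    (hg₂b : BddAbove (Set.range fun x : {x : ℝ // u₀ ≤ x} => (x : ℝ) ^ γ * |g₂ x|)) :
    -- T g is well defined:
    (∀ u, u₀ ≤ u → IntegrableOn (fun z => g (u + z) * Fbar z) (Set.Ioi 0)) ∧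
    (∀ u, u₀ ≤ u → IntegrableOn
      (fun t => t ^ (γ - 2) * Real.exp (α / t) * ∫ z in Set.Ioi (0 : ℝ), g (t + z) * Fbar z)
      (Set.Ioi u)) ∧
    -- T g is continuous on [u₀,∞) with finite weighted norm:
    ContinuousOn (opT μ α γ Fbar g) (Set.Ici u₀) ∧
    BddAbove (Set.range fun x : {x : ℝ // u₀ ≤ x} => (x : ℝ) ^ γ * |opT μ α γ Fbar g x|) ∧
    -- norm bound:
    pnorm γ u₀ (opT μ α γ Fbar g) ≤ μ * m / u₀ * pnorm γ u₀ g ∧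
    -- Lipschitz bound:
    pnorm γ u₀ (fun x => opT μ α γ Fbar g₁ x - opT μ α γ Fbar g₂ x) ≤
      μ * m / u₀ * pnorm γ u₀ (fun x => g₁ x - g₂ x) ∧
    -- in particular, a contraction constant `< 1` when `u₀ > μ m`:
    (μ * m < u₀ → μ * m / u₀ < 1) := by
  subst hm
  have hF_nonneg : ∀ z ∈ Ioi (0 : ℝ), 0 ≤ Fbar z := fun z hz => (hF_mem z (Ioi_subset_Ici_self hz)).1
  have hM := fun x (hx : u₀ ≤ x) => rpow_abs_le_pnorm hgb hx
  have hM₁ := fun x (hx : u₀ ≤ x) => rpow_abs_le_pnorm hg₁b hx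
  have hM₂ := fun x (hx : u₀ ≤ x) => rpow_abs_le_pnorm hg₂b hx
  have hdb : BddAbove
      (Set.range fun x : {x : ℝ // u₀ ≤ x} => (x : ℝ) ^ γ * |g₁ x - g₂ x|) := by
    refine ⟨pnorm γ u₀ g₁ + pnorm γ u₀ g₂, ?_⟩
    rintro _ ⟨x, rfl⟩
    have hx : 0 ≤ (x : ℝ) ^ γ := Real.rpow_nonneg (hu₀.le.trans x.2) _
    calc _ ≤ (x : ℝ) ^ γ * (|g₁ x| + |g₂ x|) := mul_le_mul_of_nonneg_left (abs_sub _ _) hx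
      _ ≤ _ := by rw [mul_add]; exact add_le_add (hM₁ x x.2) (hM₂ x x.2)
  have hT := fun u (hu : u₀ ≤ u) => rpow_abs_opT_le hμ hα hγ hF_nonneg hF_int hu₀ hM hu
  refine ⟨fun u hu => integrableOn_shift_mul hγ hF_nonneg hF_int hu₀ hg hM hu,
    fun u hu => integrableOn_opT_integrand hα hγ hF_nonneg hF_int hu₀ hg hM hu,
    continuousOn_opT μ hα hγ hF_nonneg hF_int hu₀ hg hM,
    ⟨_, forall_mem_range.2 fun x => hT x x.2⟩, pnorm_le hT, pnorm_le fun u hu => ?_,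
    fun h => (div_lt_one hu₀).2 h⟩
  rw [← opT_sub μ hα hγ hF_nonneg hF_int hu₀ hg₁ hM₁ hg₂ hM₂ hu]
  exact rpow_abs_opT_le hμ hα hγ hF_nonneg hF_int hu₀
    (fun x hx => rpow_abs_le_pnorm (g := fun x => g₁ x - g₂ x) hdb hx) hu
end

section
/- (Lemma 1 of the paper.) Suppose γ > 0 and let u₀ > μ m. Then the integro-differential equation u² g'(u) + (γ u − α) g(u) = −A g(u) has on [u₀,∞) a unique classical solution g* (continuous on [u₀,∞), continuously differentiable on (u₀,∞), with ‖g*‖_{γ,u₀} < ∞) such that u^γ g*(u) → 1 as u → ∞; moreover g*(u) > 0 for all u ≥ u₀. -/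
open MeasureTheory Set Filter Topology

/-- The integral operator `A g (u) = μ ∫₀^∞ g(u+z) F̄(z) dz`. -/
noncomputable def opA (μ : ℝ) (Fbar g : ℝ → ℝ) (u : ℝ) : ℝ :=
  μ * ∫ z in Set.Ioi (0 : ℝ), g (u + z) * Fbar z

/-- `g` is a classical solution on `[u₀,∞)` of the integro-differential equation
`u² g'(u) + (γu - α) g(u) = -A g(u)` with finite weighted norm `‖g‖_{γ,u₀}`. -/
def IsClassicalSol (μ α γ : ℝ) (Fbar : ℝ → ℝ) (u₀ : ℝ) (g : ℝ → ℝ) : Prop :=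
  ContinuousOn g (Set.Ici u₀) ∧
  (∀ u ∈ Set.Ioi u₀, DifferentiableAt ℝ g u) ∧
  ContinuousOn (deriv g) (Set.Ioi u₀) ∧
  BddAbove (Set.range fun x : {x : ℝ // u₀ ≤ x} => (x : ℝ) ^ γ * |g x|) ∧
  (∀ u ∈ Set.Ioi u₀, u ^ 2 * deriv g u + (γ * u - α) * g u = -opA μ Fbar g u)

open scoped BoundedContinuousFunction

/-- The weighted right-hand side `e^{α/s} s^{γ-2} A(x^{-γ} φ)(s)` whose tail integral appears when
the equation is solved for `u^γ g(u)` by variation of constants. -/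
noncomputable def weightedSource (μ α γ : ℝ) (Fbar φ : ℝ → ℝ) (s : ℝ) : ℝ :=
  Real.exp (α / s) / s ^ 2 * (s ^ γ * opA μ Fbar (fun x => x ^ (-γ) * φ x) s)

/-- The integral operator whose fixed points `φ` correspond to solutions `u^{-γ} φ(u)` of the
equation with `φ(u) → 1`. -/
noncomputable def volterraOp (μ α γ : ℝ) (Fbar φ : ℝ → ℝ) (u : ℝ) : ℝ :=
  Real.exp (-(α / u)) * (1 + ∫ s in Ioi u, weightedSource μ α γ Fbar φ s)

lemma hasDerivAt_const_div_id (α : ℝ) {s : ℝ} (hs : s ≠ 0) :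
    HasDerivAt (fun x => α / x) (-(α / s ^ 2)) s := by
  simpa [div_eq_mul_inv] using (hasDerivAt_inv hs).const_mul α

lemma hasDerivAt_neg_exp_div {α s : ℝ} (hα : 0 < α) (hs : 0 < s) :
    HasDerivAt (fun x => -(Real.exp (α / x) / α)) (Real.exp (α / s) / s ^ 2) s := by
  refine ((hasDerivAt_const_div_id α hs.ne').exp.div_const α).neg.congr_deriv ?_
  field_simp

lemma tendsto_exp_div_atTop (α : ℝ) :
    Tendsto (fun x : ℝ => Real.exp (α / x)) atTop (𝓝 1) := by
  simpa using (tendsto_const_nhds.div_atTop tendsto_id : Tendsto (fun x : ℝ => α / x) _ _).rexp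

lemma tendsto_neg_exp_div (α : ℝ) :
    Tendsto (fun x : ℝ => -(Real.exp (α / x) / α)) atTop (𝓝 (-(1 / α))) :=
  ((tendsto_exp_div_atTop α).div_const α).neg

lemma integrableOn_exp_div_sq {α u : ℝ} (hα : 0 < α) (hu : 0 < u) :
    IntegrableOn (fun s => Real.exp (α / s) / s ^ 2) (Ioi u) :=
  integrableOn_Ioi_deriv_of_nonneg'
    (fun _ hx => hasDerivAt_neg_exp_div hα (hu.trans_le hx))
    (fun _ _ => by positivity) (tendsto_neg_exp_div α)

lemma integral_exp_div_sq {α u : ℝ} (hα : 0 < α) (hu : 0 < u) :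
    ∫ s in Ioi u, Real.exp (α / s) / s ^ 2 = (Real.exp (α / u) - 1) / α := by
  rw [integral_Ioi_of_hasDerivAt_of_nonneg'
    (fun _ hx => hasDerivAt_neg_exp_div hα (hu.trans_le hx))
    (fun _ _ => by positivity) (tendsto_neg_exp_div α)]
  ring

section Source

variable {μ α γ : ℝ} {Fbar : ℝ → ℝ}

lemma norm_opA_integrand_le (hγ : 0 < γ) (hF0 : ∀ z ∈ Ioi (0 : ℝ), 0 ≤ Fbar z)
    (φ : ℝ →ᵇ ℝ) {a u z : ℝ} (ha : 0 < a) (hu : a ≤ u) (hz : z ∈ Ioi (0 : ℝ)) :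
    ‖(u + z) ^ (-γ) * φ (u + z) * Fbar z‖ ≤ a ^ (-γ) * ‖φ‖ * Fbar z := by
  have hz' : 0 < z := hz
  have h1 : (u + z) ^ (-γ) ≤ a ^ (-γ) :=
    Real.rpow_le_rpow_of_nonpos ha (by linarith) (by linarith)
  have h0 : 0 ≤ (u + z) ^ (-γ) := Real.rpow_nonneg (by linarith) _
  rw [norm_mul, norm_mul, Real.norm_of_nonneg (hF0 z hz), Real.norm_of_nonneg h0]
  gcongr
  · exact hF0 z hz
  · exact φ.norm_coe_le_norm _

lemma aestronglyMeasurable_opA_integrand (hF_int : IntegrableOn Fbar (Ioi 0))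
    (φ : ℝ →ᵇ ℝ) (u : ℝ) :
    AEStronglyMeasurable (fun z => (u + z) ^ (-γ) * φ (u + z) * Fbar z)
      (volume.restrict (Ioi 0)) := by
  refine AEStronglyMeasurable.mul ?_ hF_int.aestronglyMeasurable
  have : Measurable fun z => (u + z) ^ (-γ) * φ (u + z) :=
    ((measurable_const.add measurable_id).pow_const _).mul
      (φ.continuous.measurable.comp (measurable_const.add measurable_id))
  exact this.aestronglyMeasurable

lemma integrableOn_opA_integrand (hγ : 0 < γ) (hF0 : ∀ z ∈ Ioi (0 : ℝ), 0 ≤ Fbar z)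
    (hF_int : IntegrableOn Fbar (Ioi 0)) (φ : ℝ →ᵇ ℝ) {u : ℝ} (hu : 0 < u) :
    IntegrableOn (fun z => (u + z) ^ (-γ) * φ (u + z) * Fbar z) (Ioi 0) := by
  refine Integrable.mono' (hF_int.const_mul (u ^ (-γ) * ‖φ‖))
    (aestronglyMeasurable_opA_integrand hF_int φ u) ?_
  filter_upwards [ae_restrict_mem measurableSet_Ioi] with z hz
  exact norm_opA_integrand_le hγ hF0 φ hu le_rfl hz

lemma abs_opA_le (hμ : 0 < μ) (hγ : 0 < γ) (hF0 : ∀ z ∈ Ioi (0 : ℝ), 0 ≤ Fbar z)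
    (hF_int : IntegrableOn Fbar (Ioi 0)) (φ : ℝ →ᵇ ℝ) {u : ℝ} (hu : 0 < u) :
    |opA μ Fbar (fun x => x ^ (-γ) * φ x) u| ≤
      u ^ (-γ) * (μ * (∫ z in Ioi (0 : ℝ), Fbar z) * ‖φ‖) := by
  have h := norm_integral_le_of_norm_le (μ := volume.restrict (Ioi 0))
    (f := fun z => (u + z) ^ (-γ) * φ (u + z) * Fbar z)
    (hF_int.const_mul (u ^ (-γ) * ‖φ‖)) (by
      filter_upwards [ae_restrict_mem measurableSet_Ioi] with z hz
      exact norm_opA_integrand_le hγ hF0 φ hu le_rfl hz)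
  rw [integral_const_mul, Real.norm_eq_abs] at h
  rw [opA, abs_mul, abs_of_pos hμ]
  calc _ ≤ μ * (u ^ (-γ) * ‖φ‖ * ∫ z in Ioi (0 : ℝ), Fbar z) := by gcongr
    _ = _ := by ring

lemma continuousOn_opA (hγ : 0 < γ) (hF0 : ∀ z ∈ Ioi (0 : ℝ), 0 ≤ Fbar z)
    (hF_int : IntegrableOn Fbar (Ioi 0)) (φ : ℝ →ᵇ ℝ) :
    ContinuousOn (opA μ Fbar fun x => x ^ (-γ) * φ x) (Ioi 0) := by
  intro u hu
  have hu' : (0 : ℝ) < u := hu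
  have key : ContinuousOn (fun x => ∫ z in Ioi (0 : ℝ), (x + z) ^ (-γ) * φ (x + z) * Fbar z)
      (Ici (u / 2)) := by
    refine continuousOn_of_dominated
      (bound := fun z => (u / 2) ^ (-γ) * ‖φ‖ * Fbar z)
      (fun x _ => aestronglyMeasurable_opA_integrand hF_int φ x) ?_ (hF_int.const_mul _) ?_
    · intro x hx
      filter_upwards [ae_restrict_mem measurableSet_Ioi] with z hz
      exact norm_opA_integrand_le hγ hF0 φ (by positivity) hx hz
    · filter_upwards [ae_restrict_mem measurableSet_Ioi] with z hz
      refine ContinuousOn.mul_const (ContinuousOn.mul ?_ (by fun_prop)) _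
      refine ContinuousOn.rpow_const (by fun_prop) fun x hx => Or.inl ?_
      have h1 : u / 2 ≤ x := hx
      have h2 : 0 < z := hz
      linarith
  have h := (continuousOn_const (c := μ)).mul key
  exact (h.continuousAt (Ici_mem_nhds (by linarith))).continuousWithinAt

lemma continuousOn_weightedSource (hγ : 0 < γ) (hF0 : ∀ z ∈ Ioi (0 : ℝ), 0 ≤ Fbar z)
    (hF_int : IntegrableOn Fbar (Ioi 0)) (φ : ℝ →ᵇ ℝ) :
    ContinuousOn (weightedSource μ α γ Fbar φ) (Ioi 0) := by
  have hne : ∀ x ∈ Ioi (0 : ℝ), x ≠ 0 := fun x hx => ne_of_gt hx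
  refine ContinuousOn.mul (ContinuousOn.div ?_ (by fun_prop) fun x hx => pow_ne_zero 2 (hne x hx))
    (ContinuousOn.mul ?_ (continuousOn_opA hγ hF0 hF_int φ))
  · exact (continuousOn_const.div continuousOn_id hne).rexp
  · exact continuousOn_id.rpow_const fun x hx => Or.inl (hne x hx)

lemma norm_weightedSource_le (hμ : 0 < μ) (hγ : 0 < γ) (hF0 : ∀ z ∈ Ioi (0 : ℝ), 0 ≤ Fbar z)
    (hF_int : IntegrableOn Fbar (Ioi 0)) (φ : ℝ →ᵇ ℝ) {s : ℝ} (hs : 0 < s) :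
    ‖weightedSource μ α γ Fbar φ s‖ ≤
      μ * (∫ z in Ioi (0 : ℝ), Fbar z) * ‖φ‖ * (Real.exp (α / s) / s ^ 2) := by
  have h := abs_opA_le hμ hγ hF0 hF_int φ hs
  have hp : 0 < s ^ γ := Real.rpow_pos_of_pos hs _
  rw [weightedSource, norm_mul, norm_mul, Real.norm_of_nonneg hp.le,
    Real.norm_of_nonneg (by positivity), Real.norm_eq_abs]
  calc _ ≤ Real.exp (α / s) / s ^ 2 * (s ^ γ * (s ^ (-γ) *
        (μ * (∫ z in Ioi (0 : ℝ), Fbar z) * ‖φ‖))) := by gcongr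
    _ = _ := by
      rw [Real.rpow_neg hs.le]
      field_simp

lemma integrableOn_weightedSource (hμ : 0 < μ) (hα : 0 < α) (hγ : 0 < γ)
    (hF0 : ∀ z ∈ Ioi (0 : ℝ), 0 ≤ Fbar z) (hF_int : IntegrableOn Fbar (Ioi 0)) (φ : ℝ →ᵇ ℝ)
    {u : ℝ} (hu : 0 < u) : IntegrableOn (weightedSource μ α γ Fbar φ) (Ioi u) := by
  refine Integrable.mono' ((integrableOn_exp_div_sq hα hu).const_mul
    (μ * (∫ z in Ioi (0 : ℝ), Fbar z) * ‖φ‖))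
    (((continuousOn_weightedSource hγ hF0 hF_int φ).mono
      (Ioi_subset_Ioi hu.le)).aestronglyMeasurable measurableSet_Ioi) ?_
  filter_upwards [ae_restrict_mem measurableSet_Ioi] with s hs
  exact norm_weightedSource_le hμ hγ hF0 hF_int φ (hu.trans hs)

lemma abs_integral_weightedSource_le (hμ : 0 < μ) (hα : 0 < α) (hγ : 0 < γ)
    (hF0 : ∀ z ∈ Ioi (0 : ℝ), 0 ≤ Fbar z) (hF_int : IntegrableOn Fbar (Ioi 0)) (φ : ℝ →ᵇ ℝ)
    {u : ℝ} (hu : 0 < u) :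
    |∫ s in Ioi u, weightedSource μ α γ Fbar φ s| ≤
      μ * (∫ z in Ioi (0 : ℝ), Fbar z) * ‖φ‖ * ((Real.exp (α / u) - 1) / α) := by
  rw [← integral_exp_div_sq hα hu, ← integral_const_mul, ← Real.norm_eq_abs]
  refine norm_integral_le_of_norm_le ((integrableOn_exp_div_sq hα hu).const_mul _) ?_
  filter_upwards [ae_restrict_mem measurableSet_Ioi] with s hs
  exact norm_weightedSource_le hμ hγ hF0 hF_int φ (hu.trans hs)

lemma abs_exp_mul_integral_weightedSource_le (hμ : 0 < μ) (hα : 0 < α) (hγ : 0 < γ)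
    (hF0 : ∀ z ∈ Ioi (0 : ℝ), 0 ≤ Fbar z) (hF_int : IntegrableOn Fbar (Ioi 0)) (φ : ℝ →ᵇ ℝ)
    {a u : ℝ} (ha : 0 < a) (hu : a ≤ u) :
    |Real.exp (-(α / u)) * ∫ s in Ioi u, weightedSource μ α γ Fbar φ s| ≤
      μ * (∫ z in Ioi (0 : ℝ), Fbar z) / a * ‖φ‖ := by
  have hu0 : 0 < u := ha.trans_le hu
  have hM : 0 ≤ ∫ z in Ioi (0 : ℝ), Fbar z := setIntegral_nonneg measurableSet_Ioi hF0
  have hexp : Real.exp (-(α / u)) * ((Real.exp (α / u) - 1) / α) ≤ 1 / a := by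
    have h1 : Real.exp (-(α / u)) * ((Real.exp (α / u) - 1) / α) =
        (1 - Real.exp (-(α / u))) / α := by
      rw [Real.exp_neg]
      field_simp
    have h2 : 1 - Real.exp (-(α / u)) ≤ α / u := by
      have := Real.add_one_le_exp (-(α / u))
      linarith
    calc _ = (1 - Real.exp (-(α / u))) / α := h1
      _ ≤ α / u / α := by gcongr
      _ = 1 / u := by field_simp
      _ ≤ 1 / a := by gcongr
  rw [abs_mul, abs_of_pos (Real.exp_pos _)]
  calc _ ≤ Real.exp (-(α / u)) * (μ * (∫ z in Ioi (0 : ℝ), Fbar z) * ‖φ‖ *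
        ((Real.exp (α / u) - 1) / α)) := by
        gcongr
        exact abs_integral_weightedSource_le hμ hα hγ hF0 hF_int φ hu0
    _ = μ * (∫ z in Ioi (0 : ℝ), Fbar z) * ‖φ‖ *
        (Real.exp (-(α / u)) * ((Real.exp (α / u) - 1) / α)) := by ring
    _ ≤ μ * (∫ z in Ioi (0 : ℝ), Fbar z) * ‖φ‖ * (1 / a) := by gcongr
    _ = _ := by ring

lemma weightedSource_sub (hγ : 0 < γ) (hF0 : ∀ z ∈ Ioi (0 : ℝ), 0 ≤ Fbar z)
    (hF_int : IntegrableOn Fbar (Ioi 0)) (φ ψ : ℝ →ᵇ ℝ) {s : ℝ} (hs : 0 < s) :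
    weightedSource μ α γ Fbar (φ - ψ : ℝ →ᵇ ℝ) s =
      weightedSource μ α γ Fbar φ s - weightedSource μ α γ Fbar ψ s := by
  have h : opA μ Fbar (fun x => x ^ (-γ) * (φ - ψ : ℝ →ᵇ ℝ) x) s =
      opA μ Fbar (fun x => x ^ (-γ) * φ x) s - opA μ Fbar (fun x => x ^ (-γ) * ψ x) s := by
    rw [opA, opA, opA, ← mul_sub, ← integral_sub (integrableOn_opA_integrand hγ hF0 hF_int φ hs)
      (integrableOn_opA_integrand hγ hF0 hF_int ψ hs)]
    congr 2 with z
    rw [BoundedContinuousFunction.sub_apply]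
    ring
  rw [weightedSource, weightedSource, weightedSource, h]
  ring

lemma weightedSource_nonneg (hμ : 0 < μ) (hF0 : ∀ z ∈ Ioi (0 : ℝ), 0 ≤ Fbar z) {φ : ℝ → ℝ}
    (hφ : ∀ x, 0 ≤ φ x) {s : ℝ} (hs : 0 < s) : 0 ≤ weightedSource μ α γ Fbar φ s := by
  have h : 0 ≤ ∫ z in Ioi (0 : ℝ), (s + z) ^ (-γ) * φ (s + z) * Fbar z := by
    refine setIntegral_nonneg measurableSet_Ioi fun z hz => ?_
    have hz' : 0 < z := hz
    exact mul_nonneg (mul_nonneg (Real.rpow_nonneg (by linarith) _) (hφ _)) (hF0 z hz)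
  have hp : 0 < s ^ γ := Real.rpow_pos_of_pos hs _
  unfold weightedSource opA
  positivity

lemma hasDerivAt_integral_weightedSource (hμ : 0 < μ) (hα : 0 < α) (hγ : 0 < γ)
    (hF0 : ∀ z ∈ Ioi (0 : ℝ), 0 ≤ Fbar z) (hF_int : IntegrableOn Fbar (Ioi 0)) (φ : ℝ →ᵇ ℝ)
    {u : ℝ} (hu : 0 < u) :
    HasDerivAt (fun v => ∫ s in Ioi v, weightedSource μ α γ Fbar φ s)
      (-weightedSource μ α γ Fbar φ u) u := by
  have hint : ∀ {v : ℝ}, 0 < v → IntegrableOn (weightedSource μ α γ Fbar φ) (Ioi v) :=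
    fun hv => integrableOn_weightedSource hμ hα hγ hF0 hF_int φ hv
  have hcont := continuousOn_weightedSource (μ := μ) (α := α) hγ hF0 hF_int φ
  have hu2 : 0 < u / 2 := by positivity
  have hle : u / 2 ≤ u := by linarith
  have h1 : HasDerivAt (fun v => ∫ s in (u / 2)..v, weightedSource μ α γ Fbar φ s)
      (weightedSource μ α γ Fbar φ u) u := by
    refine intervalIntegral.integral_hasDerivAt_right ?_ ?_ (hcont.continuousAt (Ioi_mem_nhds hu))
    · exact (intervalIntegrable_iff_integrableOn_Ioc_of_le hle).2
        ((hint hu2).mono_set Ioc_subset_Ioi_self)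
    · exact hcont.stronglyMeasurableAtFilter isOpen_Ioi u hu
  refine (h1.const_sub (∫ s in Ioi (u / 2), weightedSource μ α γ Fbar φ s)).congr_of_eventuallyEq ?_
  filter_upwards [Ioi_mem_nhds hu] with v hv
  rw [← intervalIntegral.integral_interval_add_Ioi (hint hu2) (hint hv)]
  ring

lemma hasDerivAt_volterraOp (hμ : 0 < μ) (hα : 0 < α) (hγ : 0 < γ)
    (hF0 : ∀ z ∈ Ioi (0 : ℝ), 0 ≤ Fbar z) (hF_int : IntegrableOn Fbar (Ioi 0)) (φ : ℝ →ᵇ ℝ)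
    {u : ℝ} (hu : 0 < u) :
    HasDerivAt (volterraOp μ α γ Fbar φ)
      (α / u ^ 2 * volterraOp μ α γ Fbar φ u -
        u ^ γ * opA μ Fbar (fun x => x ^ (-γ) * φ x) u / u ^ 2) u := by
  refine ((hasDerivAt_const_div_id α hu.ne').fun_neg.exp.mul ((hasDerivAt_integral_weightedSource hμ hα hγ hF0 hF_int φ hu).const_add
    1)).congr_deriv ?_
  rw [volterraOp, weightedSource, Real.exp_neg]
  field_simp
  ring

lemma tendsto_volterraOp (hμ : 0 < μ) (hα : 0 < α) (hγ : 0 < γ)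
    (hF0 : ∀ z ∈ Ioi (0 : ℝ), 0 ≤ Fbar z) (hF_int : IntegrableOn Fbar (Ioi 0)) (φ : ℝ →ᵇ ℝ) :
    Tendsto (volterraOp μ α γ Fbar φ) atTop (𝓝 1) := by
  have h1 : Tendsto (fun u : ℝ => μ * (∫ z in Ioi (0 : ℝ), Fbar z) * ‖φ‖ *
      ((Real.exp (α / u) - 1) / α)) atTop (𝓝 0) := by
    simpa using (((tendsto_exp_div_atTop α).sub_const 1).div_const α).const_mul
      (μ * (∫ z in Ioi (0 : ℝ), Fbar z) * ‖φ‖)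
  have h2 : Tendsto (fun u => ∫ s in Ioi u, weightedSource μ α γ Fbar φ s) atTop (𝓝 0) := by
    refine squeeze_zero_norm' ?_ h1
    filter_upwards [eventually_gt_atTop 0] with u hu
    exact abs_integral_weightedSource_le hμ hα hγ hF0 hF_int φ hu
  have h3 : Tendsto (fun u : ℝ => Real.exp (-(α / u))) atTop (𝓝 1) := by
    simpa [neg_div] using tendsto_exp_div_atTop (-α)
  have h4 := h3.mul (h2.const_add 1)
  rwa [add_zero, mul_one] at h4

lemma exists_boundedContinuous_volterraOp (hμ : 0 < μ) (hα : 0 < α) (hγ : 0 < γ)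
    (hF0 : ∀ z ∈ Ioi (0 : ℝ), 0 ≤ Fbar z) (hF_int : IntegrableOn Fbar (Ioi 0))
    {u₀ : ℝ} (hu₀ : 0 < u₀) (φ : ℝ →ᵇ ℝ) :
    ∃ ψ : ℝ →ᵇ ℝ, ∀ x, ψ x = volterraOp μ α γ Fbar φ (max x u₀) := by
  have hpos : ∀ x, 0 < max x u₀ := fun x => lt_max_of_lt_right hu₀
  refine ⟨BoundedContinuousFunction.ofNormedAddCommGroup
    (fun x => volterraOp μ α γ Fbar φ (max x u₀)) ?_
    (1 + μ * (∫ z in Ioi (0 : ℝ), Fbar z) / u₀ * ‖φ‖) ?_, fun x => rfl⟩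
  · refine continuous_iff_continuousAt.2 fun x => ?_
    exact (hasDerivAt_volterraOp hμ hα hγ hF0 hF_int φ (hpos x)).continuousAt.comp
      (f := fun x => max x u₀) (by fun_prop)
  · intro x
    rw [volterraOp, mul_add, mul_one]
    refine (norm_add_le _ _).trans (add_le_add ?_ ?_)
    · rw [Real.norm_of_nonneg (Real.exp_pos _).le, Real.exp_le_one_iff]
      have := (hpos x).le
      have : 0 ≤ α / max x u₀ := by positivity
      linarith
    · exact abs_exp_mul_integral_weightedSource_le hμ hα hγ hF0 hF_int φ hu₀ (le_max_right _ _)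

lemma abs_volterraOp_sub_le (hμ : 0 < μ) (hα : 0 < α) (hγ : 0 < γ)
    (hF0 : ∀ z ∈ Ioi (0 : ℝ), 0 ≤ Fbar z) (hF_int : IntegrableOn Fbar (Ioi 0)) (φ ψ : ℝ →ᵇ ℝ)
    {a u : ℝ} (ha : 0 < a) (hu : a ≤ u) :
    |volterraOp μ α γ Fbar φ u - volterraOp μ α γ Fbar ψ u| ≤
      μ * (∫ z in Ioi (0 : ℝ), Fbar z) / a * ‖φ - ψ‖ := by
  have hu0 : 0 < u := ha.trans_le hu
  have h : volterraOp μ α γ Fbar φ u - volterraOp μ α γ Fbar ψ u = Real.exp (-(α / u)) *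
      ∫ s in Ioi u, weightedSource μ α γ Fbar (φ - ψ : ℝ →ᵇ ℝ) s := by
    rw [setIntegral_congr_fun measurableSet_Ioi fun s hs =>
        weightedSource_sub hγ hF0 hF_int φ ψ (hu0.trans hs),
      integral_sub (integrableOn_weightedSource hμ hα hγ hF0 hF_int φ hu0)
        (integrableOn_weightedSource hμ hα hγ hF0 hF_int ψ hu0), volterraOp, volterraOp]
    ring
  rw [h]
  exact abs_exp_mul_integral_weightedSource_le hμ hα hγ hF0 hF_int _ ha hu

lemma isClassicalSol_of_eqOn_volterraOp (hμ : 0 < μ) (hα : 0 < α) (hγ : 0 < γ)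
    (hF0 : ∀ z ∈ Ioi (0 : ℝ), 0 ≤ Fbar z) (hF_int : IntegrableOn Fbar (Ioi 0))
    {u₀ : ℝ} (hu₀ : 0 < u₀) (φ : ℝ →ᵇ ℝ) (hφ : ∀ u ∈ Ici u₀, φ u = volterraOp μ α γ Fbar φ u) :
    IsClassicalSol μ α γ Fbar u₀ (fun x => x ^ (-γ) * φ x) := by
  have hder : ∀ u ∈ Ioi u₀, HasDerivAt (fun x => x ^ (-γ) * φ x)
      ((-opA μ Fbar (fun x => x ^ (-γ) * φ x) u - (γ * u - α) * (u ^ (-γ) * φ u)) / u ^ 2) u := by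
    intro u hu
    have hu0 : 0 < u := hu₀.trans hu
    have h1 := (hasDerivAt_volterraOp hμ hα hγ hF0 hF_int φ hu0).congr_of_eventuallyEq
      (f₁ := φ) (by
        filter_upwards [Ioi_mem_nhds (mem_Ioi.1 hu)] with v hv using hφ v (mem_Ioi.1 hv).le)
    rw [← hφ u (mem_Ioi.1 hu).le] at h1
    refine ((Real.hasDerivAt_rpow_const (p := -γ) (Or.inl hu0.ne')).mul h1).congr_deriv ?_
    have hp : 0 < u ^ γ := Real.rpow_pos_of_pos hu0 _
    rw [Real.rpow_sub_one hu0.ne', Real.rpow_neg hu0.le]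
    field_simp
    ring
  have hrpow : ContinuousOn (fun x : ℝ => x ^ (-γ)) (Ioi 0) :=
    continuousOn_id.rpow_const fun x hx => Or.inl (ne_of_gt hx)
  have hg : ContinuousOn (fun x => x ^ (-γ) * φ x) (Ioi 0) := hrpow.mul φ.continuous.continuousOn
  refine ⟨hg.mono fun x hx => hu₀.trans_le hx, fun u hu => (hder u hu).differentiableAt, ?_, ?_, ?_⟩
  · have hc : ContinuousOn (fun u => (-opA μ Fbar (fun x => x ^ (-γ) * φ x) u -
        (γ * u - α) * (u ^ (-γ) * φ u)) / u ^ 2) (Ioi 0) :=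
      ((continuousOn_opA hγ hF0 hF_int φ).neg.sub (ContinuousOn.mul (by fun_prop) hg)).div
        (by fun_prop) fun x hx => pow_ne_zero 2 (ne_of_gt hx)
    exact (hc.mono (Ioi_subset_Ioi hu₀.le)).congr fun u hu => (hder u hu).deriv
  · refine ⟨‖φ‖, ?_⟩
    rintro _ ⟨⟨x, hx⟩, rfl⟩
    have hx0 : 0 < x := hu₀.trans_le hx
    have hp : 0 < x ^ γ := Real.rpow_pos_of_pos hx0 _
    simp only [Real.rpow_neg hx0.le, abs_mul, abs_of_pos (inv_pos.2 hp)]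
    rw [mul_inv_cancel_left₀ hp.ne']
    exact φ.norm_coe_le_norm x
  · intro u hu
    have hu0 : 0 < u := hu₀.trans hu
    rw [(hder u hu).deriv]
    field_simp
    ring

lemma IsClassicalSol.exists_boundedContinuous (hγ : 0 < γ) {u₀ : ℝ} (hu₀ : 0 < u₀) {h : ℝ → ℝ}
    (hh : IsClassicalSol μ α γ Fbar u₀ h) :
    ∃ φ : ℝ →ᵇ ℝ, ∀ x, φ x = max x u₀ ^ γ * h (max x u₀) := by
  obtain ⟨hcont, -, -, ⟨C, hC⟩, -⟩ := hh
  refine ⟨BoundedContinuousFunction.ofNormedAddCommGroup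
    (fun x => max x u₀ ^ γ * h (max x u₀)) ?_ C ?_, fun x => rfl⟩
  · refine Continuous.mul ?_ ?_
    · exact Continuous.rpow_const (by fun_prop) fun x => Or.inr hγ.le
    · exact hcont.comp_continuous (by fun_prop) fun x => le_max_right x u₀
  · intro x
    have hp : 0 ≤ max x u₀ ^ γ := Real.rpow_nonneg (hu₀.le.trans (le_max_right _ _)) _
    rw [norm_mul, Real.norm_of_nonneg hp]
    exact hC ⟨⟨max x u₀, le_max_right _ _⟩, rfl⟩

lemma IsClassicalSol.eq_volterraOp (hμ : 0 < μ) (hα : 0 < α) (hγ : 0 < γ)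
    (hF0 : ∀ z ∈ Ioi (0 : ℝ), 0 ≤ Fbar z) (hF_int : IntegrableOn Fbar (Ioi 0))
    {u₀ : ℝ} (hu₀ : 0 < u₀) {h : ℝ → ℝ} (hh : IsClassicalSol μ α γ Fbar u₀ h)
    (hlim : Tendsto (fun u => u ^ γ * h u) atTop (𝓝 1)) {φ : ℝ →ᵇ ℝ}
    (hφ : ∀ x, φ x = max x u₀ ^ γ * h (max x u₀)) {u : ℝ} (hu : u₀ ≤ u) :
    u ^ γ * h u = volterraOp μ α γ Fbar φ u := by
  obtain ⟨hcont, hdiff, -, -, heq⟩ := hh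
  have hu0 : 0 < u := hu₀.trans_le hu
  have hA : ∀ s, u₀ ≤ s → opA μ Fbar (fun x => x ^ (-γ) * φ x) s = opA μ Fbar h s := by
    intro s hs
    rw [opA, opA]
    congr 1
    refine setIntegral_congr_fun measurableSet_Ioi fun z hz => ?_
    have hz' : 0 < z := hz
    have hle : u₀ ≤ s + z := by linarith
    have hsz : 0 < s + z := hu₀.trans_le hle
    have hp : 0 < (s + z) ^ γ := Real.rpow_pos_of_pos hsz _
    simp only [hφ, max_eq_left hle, Real.rpow_neg hsz.le]
    field_simp
  have hcw : ContinuousOn (fun s => Real.exp (α / s) * (s ^ γ * h s)) (Ici u₀) := by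
    have hne : ∀ x ∈ Ici u₀, x ≠ 0 := fun x hx => (hu₀.trans_le hx).ne'
    refine ContinuousOn.mul ?_ (ContinuousOn.mul ?_ hcont)
    · exact (continuousOn_const.div continuousOn_id hne).rexp
    · exact continuousOn_id.rpow_const fun x hx => Or.inl (hne x hx)
  have hder : ∀ s ∈ Ioi u, HasDerivAt (fun s => Real.exp (α / s) * (s ^ γ * h s))
      (-weightedSource μ α γ Fbar φ s) s := by
    intro s hs
    have hs' : u₀ < s := hu.trans_lt hs
    have hs0 : 0 < s := hu₀.trans hs'
    refine ((hasDerivAt_const_div_id α hs0.ne').exp.mul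
      ((Real.hasDerivAt_rpow_const (p := γ) (Or.inl hs0.ne')).fun_mul (hdiff s hs').hasDerivAt)).congr_deriv ?_
    rw [weightedSource, hA s hs'.le, ← neg_eq_iff_eq_neg.2 (heq s hs'), Real.rpow_sub_one hs0.ne']
    field_simp
    ring
  have hlim' : Tendsto (fun s => Real.exp (α / s) * (s ^ γ * h s)) atTop (𝓝 1) := by
    simpa using (tendsto_exp_div_atTop α).mul hlim
  have hI := integral_Ioi_of_hasDerivAt_of_tendsto
    ((hcw u hu).mono (Ici_subset_Ici.2 hu)) hder
    (integrableOn_weightedSource hμ hα hγ hF0 hF_int φ hu0).neg hlim'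
  rw [integral_neg] at hI
  have hI' : 1 + ∫ s in Ioi u, weightedSource μ α γ Fbar φ s =
      Real.exp (α / u) * (u ^ γ * h u) := by linarith
  rw [volterraOp, hI', ← mul_assoc, ← Real.exp_add]
  simp

end Source

theorem stmt3
    (Fbar : ℝ → ℝ) (μ α γ m : ℝ)
    (hμ : 0 < μ) (hα : 0 < α) (hγ : 0 < γ)
    (hF_anti : AntitoneOn Fbar (Set.Ici 0))
    (hF_mem : ∀ y ∈ Set.Ici (0 : ℝ), Fbar y ∈ Set.Icc (0 : ℝ) 1)
    (hF_int : IntegrableOn Fbar (Set.Ioi 0))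
    (hm : m = ∫ z in Set.Ioi (0 : ℝ), Fbar z)
    (u₀ : ℝ) (hu₀ : μ * m < u₀) (hu₀pos : 0 < u₀) :
    ∃ gstar : ℝ → ℝ,
      (IsClassicalSol μ α γ Fbar u₀ gstar ∧
        Tendsto (fun u => u ^ γ * gstar u) atTop (nhds 1)) ∧
      (∀ u ∈ Set.Ici u₀, 0 < gstar u) ∧
      (∀ h : ℝ → ℝ,
        IsClassicalSol μ α γ Fbar u₀ h →
        Tendsto (fun u => u ^ γ * h u) atTop (nhds 1) →
        ∀ u ∈ Set.Ici u₀, h u = gstar u) := by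
  have hF0 : ∀ z ∈ Ioi (0 : ℝ), 0 ≤ Fbar z := fun z hz => (hF_mem z (mem_Ioi.1 hz).le).1
  have hM : 0 ≤ m := hm ▸ setIntegral_nonneg measurableSet_Ioi hF0
  choose T hT using exists_boundedContinuous_volterraOp hμ hα hγ hF0 hF_int hu₀pos
  have hq : 0 ≤ μ * m / u₀ := by positivity
  have hcontr : ContractingWith (NNReal.mk (μ * m / u₀) hq) T := by
    refine ⟨?_, LipschitzWith.of_dist_le_mul fun φ ψ => ?_⟩
    · rw [← NNReal.coe_lt_coe]
      exact (div_lt_one hu₀pos).2 hu₀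
    · refine (BoundedContinuousFunction.dist_le (mul_nonneg hq dist_nonneg)).2 fun x => ?_
      rw [hT, hT, Real.dist_eq, dist_eq_norm, hm]
      exact abs_volterraOp_sub_le hμ hα hγ hF0 hF_int φ ψ hu₀pos (le_max_right _ _)
  set φ := ContractingWith.fixedPoint T hcontr
  have hφ : ∀ u ∈ Ici u₀, φ u = volterraOp μ α γ Fbar φ u := by
    intro u hu
    have h1 : T φ u = φ u := congrArg (fun f : ℝ →ᵇ ℝ => f u) hcontr.fixedPoint_isFixedPt
    rw [← h1, hT, max_eq_left hu]
  have hstep : ∀ ψ : ℝ →ᵇ ℝ, (∀ x, 0 ≤ ψ x) → ∀ u, 0 < u → 0 < volterraOp μ α γ Fbar ψ u := by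
    intro ψ hψ u hu
    have : 0 ≤ ∫ s in Ioi u, weightedSource μ α γ Fbar ψ s :=
      setIntegral_nonneg measurableSet_Ioi fun s hs =>
        weightedSource_nonneg hμ hF0 hψ (hu.trans hs)
    unfold volterraOp
    positivity
  have hiter : ∀ n x, 0 ≤ (T^[n] 0) x := by
    intro n
    induction n with
    | zero => intro x; simp
    | succ n ih =>
      intro x
      rw [Function.iterate_succ_apply', hT]
      exact (hstep _ ih _ (lt_max_of_lt_right hu₀pos)).le
  have hφ0 : ∀ x, 0 ≤ φ x := fun x =>
    ge_of_tendsto' (((continuous_eval_const (F := ℝ →ᵇ ℝ) x).tendsto φ).comp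
      (hcontr.tendsto_iterate_fixedPoint 0)) fun n => hiter n x
  refine ⟨fun x => x ^ (-γ) * φ x,
    ⟨isClassicalSol_of_eqOn_volterraOp hμ hα hγ hF0 hF_int hu₀pos φ hφ, ?_⟩, ?_, ?_⟩
  · refine (tendsto_volterraOp hμ hα hγ hF0 hF_int φ).congr' ?_
    filter_upwards [eventually_ge_atTop u₀] with u hu
    have hu0 : 0 < u := hu₀pos.trans_le hu
    rw [← hφ u hu, Real.rpow_neg hu0.le, mul_inv_cancel_left₀ (Real.rpow_pos_of_pos hu0 _).ne']
  · intro u hu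
    have hu0 : 0 < u := hu₀pos.trans_le hu
    exact mul_pos (Real.rpow_pos_of_pos hu0 _) (hφ u hu ▸ hstep φ hφ0 u hu0)
  · intro h hh hlim u hu
    have hu0 : 0 < u := hu₀pos.trans_le hu
    obtain ⟨ψ, hψ⟩ := hh.exists_boundedContinuous hγ hu₀pos
    have hfix : T ψ = ψ := by
      ext x
      rw [hT, hψ]
      exact (hh.eq_volterraOp hμ hα hγ hF0 hF_int hu₀pos hlim hψ (le_max_right _ _)).symm
    have hψφ : ψ = φ := hcontr.fixedPoint_unique hfix
    have hu' : u₀ ≤ u := hu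
    simp only
    rw [← hψφ, hψ, max_eq_left hu', Real.rpow_neg hu0.le,
      inv_mul_cancel_left₀ (Real.rpow_pos_of_pos hu0 _).ne']
end

section
/- Let u₀ > 0 and let g be continuous on [u₀,∞) with ‖g‖_{γ,u₀} < ∞. Then u^γ T g(u) → 0 as u → ∞, where T g(u) := μ u^{−γ} e^{−α/u} ∫_u^∞ t^{γ−2} e^{α/t} (∫₀^∞ g(t+z) F̄(z) dz) dt. Consequently, with g₀(u) := u^{−γ} e^{−α/u}, one has u^γ (g₀(u) + T g(u)) → 1 as u → ∞. -/
open MeasureTheory Set Filter Topology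

/-- A weighted bound `x ^ γ * |g x| ≤ C` on `[u₀, ∞)` passes to the tail average of `g`. -/
theorem norm_integral_shift_mul_le {Fbar g : ℝ → ℝ} {γ u₀ C t : ℝ} (hγ : 0 < γ) (hu₀ : 0 < u₀)
    (hF_nonneg : ∀ z, 0 < z → 0 ≤ Fbar z) (hF_int : IntegrableOn Fbar (Set.Ioi 0))
    (hC : ∀ x, u₀ ≤ x → x ^ γ * |g x| ≤ C) (ht : u₀ ≤ t) :
    ‖∫ z in Set.Ioi (0 : ℝ), g (t + z) * Fbar z‖ ≤
      C * t ^ (-γ) * ∫ z in Set.Ioi (0 : ℝ), Fbar z := by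
  have ht0 : 0 < t := hu₀.trans_le ht
  rw [← integral_const_mul]
  refine norm_integral_le_of_norm_le (hF_int.const_mul _) ?_
  refine (ae_restrict_iff' measurableSet_Ioi).2 (Eventually.of_forall fun z hz => ?_)
  have hz0 : 0 < z := hz
  rw [norm_mul, Real.norm_eq_abs, Real.norm_eq_abs, abs_of_nonneg (hF_nonneg z hz0)]
  refine mul_le_mul_of_nonneg_right ?_ (hF_nonneg z hz0)
  rw [Real.rpow_neg ht0.le, ← div_eq_mul_inv, le_div_iff₀ (Real.rpow_pos_of_pos ht0 γ), mul_comm]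
  calc t ^ γ * |g (t + z)| ≤ (t + z) ^ γ * |g (t + z)| := by
        gcongr
        linarith
    _ ≤ C := hC _ (by linarith)

/-- If `g` has finite weighted norm on `[u₀, ∞)`, then `u ^ γ * T g u = O(1 / u)`. -/
theorem norm_rpow_mul_opT_le {Fbar g : ℝ → ℝ} {μ α γ u₀ C u : ℝ} (hμ : 0 < μ) (hα : 0 < α)
    (hγ : 0 < γ) (hu₀ : 0 < u₀)
    (hF_nonneg : ∀ z, 0 < z → 0 ≤ Fbar z) (hF_int : IntegrableOn Fbar (Set.Ioi 0))
    (hC : ∀ x, u₀ ≤ x → x ^ γ * |g x| ≤ C) (hu : u₀ ≤ u) :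
    ‖u ^ γ * opT μ α γ Fbar g u‖ ≤
      μ * (Real.exp (α / u₀) * (C * ∫ z in Set.Ioi (0 : ℝ), Fbar z)) * u⁻¹ := by
  have hu0 : 0 < u := hu₀.trans_le hu
  set K := Real.exp (α / u₀) * (C * ∫ z in Set.Ioi (0 : ℝ), Fbar z) with hK
  have houter : ‖∫ t in Set.Ioi u, t ^ (γ - 2) * Real.exp (α / t) *
      ∫ z in Set.Ioi (0 : ℝ), g (t + z) * Fbar z‖ ≤ K * u⁻¹ := by
    have hval : ∫ t in Set.Ioi u, K * t ^ (-2 : ℝ) = K * u⁻¹ := by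
      rw [integral_const_mul, integral_Ioi_rpow_of_lt (by norm_num) hu0]
      norm_num [Real.rpow_neg_one]
    rw [← hval]
    refine norm_integral_le_of_norm_le
      ((integrableOn_Ioi_rpow_of_lt (by norm_num) hu0).const_mul _) ?_
    refine (ae_restrict_iff' measurableSet_Ioi).2 (Eventually.of_forall fun t ht => ?_)
    have hut : u₀ ≤ t := hu.trans (le_of_lt ht)
    have ht0 : 0 < t := hu₀.trans_le hut
    have hinner := norm_integral_shift_mul_le hγ hu₀ hF_nonneg hF_int hC hut
    have hpow : t ^ (γ - 2) * t ^ (-γ) = t ^ (-2 : ℝ) := by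
      rw [← Real.rpow_add ht0]
      ring_nf
    rw [norm_mul, norm_mul, Real.norm_of_nonneg (Real.rpow_nonneg ht0.le _),
      Real.norm_of_nonneg (Real.exp_pos _).le]
    calc _ ≤ t ^ (γ - 2) * Real.exp (α / u₀) *
          (C * t ^ (-γ) * ∫ z in Set.Ioi (0 : ℝ), Fbar z) := by gcongr
      _ = K * t ^ (-2 : ℝ) := by
        rw [← hpow, hK]
        ring
  have hcancel : u ^ γ * u ^ (-γ) = 1 := by
    rw [← Real.rpow_add hu0, add_neg_cancel, Real.rpow_zero]
  have hexp : Real.exp (-(α / u)) ≤ 1 := Real.exp_le_one_iff.2 (by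
    have := div_pos hα hu0
    linarith)
  unfold opT
  rw [← mul_assoc, show u ^ γ * (μ * u ^ (-γ) * Real.exp (-(α / u))) =
    μ * Real.exp (-(α / u)) by linear_combination μ * Real.exp (-(α / u)) * hcancel,
    norm_mul, norm_mul, Real.norm_of_nonneg hμ.le, Real.norm_of_nonneg (Real.exp_pos _).le,
    mul_assoc μ K]
  calc _ ≤ μ * 1 * (K * u⁻¹) := by gcongr
    _ = _ := by ring

theorem stmt4
    (Fbar : ℝ → ℝ) (μ α γ m : ℝ)
    (hμ : 0 < μ) (hα : 0 < α) (hγ : 0 < γ)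
    (hF_anti : AntitoneOn Fbar (Set.Ici 0))
    (hF_mem : ∀ y ∈ Set.Ici (0 : ℝ), Fbar y ∈ Set.Icc (0 : ℝ) 1)
    (hF_int : IntegrableOn Fbar (Set.Ioi 0))
    (hm : m = ∫ z in Set.Ioi (0 : ℝ), Fbar z)
    (u₀ : ℝ) (hu₀ : 0 < u₀)
    (g : ℝ → ℝ)
    (hg : ContinuousOn g (Set.Ici u₀))
    (hgb : BddAbove (Set.range fun x : {x : ℝ // u₀ ≤ x} => (x : ℝ) ^ γ * |g x|)) :
    Tendsto (fun u => u ^ γ * opT μ α γ Fbar g u) atTop (nhds 0) ∧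
    Tendsto (fun u => u ^ γ * (u ^ (-γ) * Real.exp (-(α / u)) + opT μ α γ Fbar g u))
      atTop (nhds 1) := by
  obtain ⟨C, hCub⟩ := hgb
  have hC : ∀ x, u₀ ≤ x → x ^ γ * |g x| ≤ C := fun x hx => hCub ⟨⟨x, hx⟩, rfl⟩
  have hF_nonneg : ∀ z, 0 < z → 0 ≤ Fbar z := fun z hz => (hF_mem z hz.le).1
  have hT : Tendsto (fun u => u ^ γ * opT μ α γ Fbar g u) atTop (nhds 0) := by
    refine squeeze_zero_norm' ((eventually_ge_atTop u₀).mono fun u hu =>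
      norm_rpow_mul_opT_le hμ hα hγ hu₀ hF_nonneg hF_int hC hu) ?_
    have h := (tendsto_inv_atTop_zero (𝕜 := ℝ)).const_mul
      (μ * (Real.exp (α / u₀) * (C * ∫ z in Set.Ioi (0 : ℝ), Fbar z)))
    rwa [mul_zero] at h
  refine ⟨hT, ?_⟩
  have hexp : Tendsto (fun u : ℝ => Real.exp (-(α / u))) atTop (nhds 1) := by
    simpa [Function.comp_def] using (Real.continuous_exp.tendsto _).comp
      (tendsto_const_nhds.div_atTop tendsto_id : Tendsto (fun u : ℝ => α / u) atTop (nhds 0)).neg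
  have hsum := hexp.add hT
  rw [add_zero] at hsum
  refine hsum.congr' ((eventually_gt_atTop 0).mono fun u hu => ?_)
  have hcancel : u ^ γ * u ^ (-γ) = 1 := by
    rw [← Real.rpow_add hu, add_neg_cancel, Real.rpow_zero]
  linear_combination -Real.exp (-(α / u)) * hcancel
end

section
/- Let γ > 0 and u₀ > μ m, and let g be continuous on [u₀,∞) with ‖g‖_{γ,u₀} < ∞ satisfying the fixed-point equation g = g₀ + T g on [u₀,∞), where g₀(u) := u^{−γ} e^{−α/u} and T g(u) := μ u^{−γ} e^{−α/u} ∫_u^∞ t^{γ−2} e^{α/t} (∫₀^∞ g(t+z) F̄(z) dz) dt. Then g(u) ≥ g₀(u) > 0 for all u ≥ u₀; in particular g is strictly positive on [u₀,∞). -/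
open MeasureTheory Set Filter Topology

/-- A lower bound by the negative of a nonnegative integrable function passes to the Bochner
integral, even when the function being integrated is not integrable. -/
lemma neg_integral_le_integral_of_neg_le {X : Type*} [MeasurableSpace X] {ν : Measure X}
    {f h : X → ℝ} (hh : Integrable h ν) (h0 : 0 ≤ᵐ[ν] h) (hfh : ∀ᵐ x ∂ν, -h x ≤ f x) :
    -∫ x, h x ∂ν ≤ ∫ x, f x ∂ν := by
  by_cases hf : Integrable f ν
  · rw [← integral_neg]
    exact integral_mono_ae hh.neg hf hfh
  · rw [integral_undef hf]
    exact neg_nonpos.mpr (integral_nonneg_of_ae h0)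

/-- One-sided contraction estimate for `opT` in the weighted norm with weight `t ^ γ`. -/
lemma neg_mul_rpow_le_opT {Fbar g : ℝ → ℝ} {μ α γ u₀ K : ℝ}
    (hμ : 0 < μ) (hα : 0 < α) (hγ : 0 < γ) (hu₀ : 0 < u₀) (hK : 0 ≤ K)
    (hF : ∀ y ∈ Ici (0 : ℝ), 0 ≤ Fbar y) (hF_int : IntegrableOn Fbar (Ioi 0))
    (hg : ∀ t, u₀ ≤ t → -(K * t ^ (-γ)) ≤ g t) {u : ℝ} (hu : u₀ ≤ u) :
    -(K * (μ * (∫ z in Ioi (0 : ℝ), Fbar z) / u₀) * u ^ (-γ)) ≤ opT μ α γ Fbar g u := by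
  set m := ∫ z in Ioi (0 : ℝ), Fbar z with hm
  have hm0 : 0 ≤ m := setIntegral_nonneg measurableSet_Ioi fun z hz => hF z (Ioi_subset_Ici_self hz)
  have hupos : 0 < u := hu₀.trans_le hu
  have inner : ∀ t, u < t →
      -(K * t ^ (-γ) * m) ≤ ∫ z in Ioi (0 : ℝ), g (t + z) * Fbar z := by
    intro t ht
    have htpos : 0 < t := hupos.trans ht
    have hc : 0 ≤ K * t ^ (-γ) := by positivity
    rw [hm, ← integral_const_mul]
    refine neg_integral_le_integral_of_neg_le (hF_int.const_mul _) ?_ ?_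
    · filter_upwards [ae_restrict_mem measurableSet_Ioi] with z hz
      exact mul_nonneg hc (hF z (Ioi_subset_Ici_self hz))
    · filter_upwards [ae_restrict_mem measurableSet_Ioi] with z hz
      have hz0 : 0 < z := hz
      have hFz := hF z hz0.le
      have hpow : (t + z) ^ (-γ) ≤ t ^ (-γ) :=
        Real.rpow_le_rpow_of_nonpos htpos (by linarith) (by linarith)
      have hgz : -(K * t ^ (-γ)) ≤ g (t + z) :=
        (neg_le_neg (mul_le_mul_of_nonneg_left hpow hK)).trans (hg _ (by linarith))
      rw [← neg_mul]
      exact mul_le_mul_of_nonneg_right hgz hFz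
  have outer : -(K * m * Real.exp (α / u) / u) ≤
      ∫ t in Ioi u, t ^ (γ - 2) * Real.exp (α / t) *
        ∫ z in Ioi (0 : ℝ), g (t + z) * Fbar z := by
    have hint : IntegrableOn (fun t : ℝ => t ^ (-2 : ℝ)) (Ioi u) :=
      integrableOn_Ioi_rpow_of_lt (by norm_num) hupos
    have hval : ∫ t in Ioi u, K * m * Real.exp (α / u) * t ^ (-2 : ℝ) =
        K * m * Real.exp (α / u) / u := by
      rw [integral_const_mul, integral_Ioi_rpow_of_lt (by norm_num) hupos]
      norm_num [Real.rpow_neg_one, div_eq_mul_inv]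
    rw [← hval]
    refine neg_integral_le_integral_of_neg_le (hint.const_mul _) ?_ ?_
    · filter_upwards [ae_restrict_mem measurableSet_Ioi] with t ht
      have htpos : 0 < t := hupos.trans ht
      have : 0 ≤ K * m * Real.exp (α / u) * t ^ (-2 : ℝ) := by positivity
      exact this
    · filter_upwards [ae_restrict_mem measurableSet_Ioi] with t ht
      have htpos : 0 < t := hupos.trans ht
      have hexp : Real.exp (α / t) ≤ Real.exp (α / u) :=
        Real.exp_le_exp.mpr (div_le_div_of_nonneg_left hα.le hupos (le_of_lt ht))
      have hpow : t ^ (γ - 2) * t ^ (-γ) = t ^ (-2 : ℝ) := by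
        rw [← Real.rpow_add htpos]; congr 1; ring
      calc -(K * m * Real.exp (α / u) * t ^ (-2 : ℝ))
          ≤ -(K * m * Real.exp (α / t) * t ^ (-2 : ℝ)) := by gcongr
        _ = t ^ (γ - 2) * Real.exp (α / t) * -(K * t ^ (-γ) * m) := by rw [← hpow]; ring
        _ ≤ _ := mul_le_mul_of_nonneg_left (inner t ht) (by positivity)
  have hexp : Real.exp (-(α / u)) * Real.exp (α / u) = 1 := by
    rw [← Real.exp_add, neg_add_cancel, Real.exp_zero]
  calc -(K * (μ * m / u₀) * u ^ (-γ))
      ≤ -(K * (μ * m / u) * u ^ (-γ)) := by gcongr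
    _ = -(K * (μ * m / u) * u ^ (-γ)) * (Real.exp (-(α / u)) * Real.exp (α / u)) := by
        rw [hexp, mul_one]
    _ = μ * u ^ (-γ) * Real.exp (-(α / u)) * -(K * m * Real.exp (α / u) / u) := by ring
    _ ≤ opT μ α γ Fbar g u := mul_le_mul_of_nonneg_left outer (by positivity)

theorem stmt5
    (Fbar : ℝ → ℝ) (μ α γ m : ℝ)
    (hμ : 0 < μ) (hα : 0 < α) (hγ : 0 < γ)
    (hF_anti : AntitoneOn Fbar (Set.Ici 0))
    (hF_mem : ∀ y ∈ Set.Ici (0 : ℝ), Fbar y ∈ Set.Icc (0 : ℝ) 1)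
    (hF_int : IntegrableOn Fbar (Set.Ioi 0))
    (hm : m = ∫ z in Set.Ioi (0 : ℝ), Fbar z)
    (u₀ : ℝ) (hu₀ : μ * m < u₀) (hu₀pos : 0 < u₀)
    (g : ℝ → ℝ)
    (hg : ContinuousOn g (Set.Ici u₀))
    (hgb : BddAbove (Set.range fun x : {x : ℝ // u₀ ≤ x} => (x : ℝ) ^ γ * |g x|))
    (hfix : ∀ u ∈ Set.Ici u₀, g u = u ^ (-γ) * Real.exp (-(α / u)) + opT μ α γ Fbar g u) :
    ∀ u ∈ Set.Ici u₀,
      0 < u ^ (-γ) * Real.exp (-(α / u)) ∧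
      u ^ (-γ) * Real.exp (-(α / u)) ≤ g u ∧
      0 < g u := by
  have hF : ∀ y ∈ Ici (0 : ℝ), 0 ≤ Fbar y := fun y hy => (hF_mem y hy).1
  have hm0 : 0 ≤ m := hm ▸
    setIntegral_nonneg measurableSet_Ioi fun z hz => hF z (Ioi_subset_Ici_self hz)
  have hg₀ : ∀ u, u₀ ≤ u → 0 < u ^ (-γ) * Real.exp (-(α / u)) := fun u hu =>
    mul_pos (Real.rpow_pos_of_pos (hu₀pos.trans_le hu) _) (Real.exp_pos _)
  have hT : ∀ K, 0 ≤ K → (∀ t, u₀ ≤ t → -(K * t ^ (-γ)) ≤ g t) → ∀ u, u₀ ≤ u →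
      -(K * (μ * m / u₀) * u ^ (-γ)) ≤ opT μ α γ Fbar g u := fun K hK hgK u hu =>
    hm ▸ neg_mul_rpow_le_opT hμ hα hγ hu₀pos hK hF hF_int hgK hu
  obtain ⟨C, hC⟩ := hgb
  have hC' : ∀ t, u₀ ≤ t → t ^ γ * |g t| ≤ C := fun t ht => hC ⟨⟨t, ht⟩, rfl⟩
  have hC0 : 0 ≤ C := le_trans
    (mul_nonneg (Real.rpow_nonneg hu₀pos.le _) (abs_nonneg _)) (hC' u₀ le_rfl)
  have hq0 : 0 ≤ μ * m / u₀ := by positivity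
  have hq1 : μ * m / u₀ < 1 := (div_lt_one hu₀pos).mpr hu₀
  have hiter : ∀ n : ℕ, ∀ t, u₀ ≤ t → -(C * (μ * m / u₀) ^ n * t ^ (-γ)) ≤ g t := by
    intro n
    induction n with
    | zero =>
      intro t ht
      have htpos : 0 < t := hu₀pos.trans_le ht
      have habs : |g t| ≤ C * t ^ (-γ) := by
        rw [Real.rpow_neg htpos.le, ← div_eq_mul_inv, le_div_iff₀ (Real.rpow_pos_of_pos htpos _),
          mul_comm]
        exact hC' t ht
      simpa using (abs_le.mp habs).1
    | succ n ih =>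
      intro t ht
      have := hT _ (by positivity) ih t ht
      rw [hfix t ht, pow_succ, ← mul_assoc]
      linarith [hg₀ t ht]
  have hnonneg : ∀ t, u₀ ≤ t → 0 ≤ g t := by
    intro t ht
    have hlim : Tendsto (fun n : ℕ => -(C * (μ * m / u₀) ^ n * t ^ (-γ))) atTop (𝓝 0) := by
      simpa using
        (((tendsto_pow_atTop_nhds_zero_of_lt_one hq0 hq1).const_mul C).mul_const (t ^ (-γ))).neg
    exact le_of_tendsto' hlim fun n => hiter n t ht
  intro u hu
  have hTu : 0 ≤ opT μ α γ Fbar g u := by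
    simpa using hT 0 le_rfl (by simpa using hnonneg) u hu
  have hle : u ^ (-γ) * Real.exp (-(α / u)) ≤ g u := by
    rw [hfix u hu]
    linarith
  exact ⟨hg₀ u hu, hle, (hg₀ u hu).trans_le hle⟩
end

section
/- Let γ > 0, u₀ > 0, and let g be continuous on [u₀,∞) with ‖g‖_{γ,u₀} < ∞ satisfying g(u) = u^{−γ} e^{−α/u} + μ u^{−γ} e^{−α/u} ∫_u^∞ t^{γ−2} e^{α/t} (∫₀^∞ g(t+z) F̄(z) dz) dt for all u ≥ u₀. Then g is continuously differentiable on (u₀,∞) and satisfies the integro-differential equation u² g'(u) + (γ u − α) g(u) = −A g(u) for all u > u₀. -/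
open MeasureTheory Set Filter Topology

/-- On `[u₀,∞)` a function with finite weighted sup norm is dominated by `C x^{-γ}`. -/
theorem exists_abs_le_rpow_neg {γ u₀ : ℝ} (hu₀ : 0 < u₀) {g : ℝ → ℝ}
    (hgb : BddAbove (Set.range fun x : {x : ℝ // u₀ ≤ x} => (x : ℝ) ^ γ * |g x|)) :
    ∃ C, 0 ≤ C ∧ ∀ x, u₀ ≤ x → |g x| ≤ C * x ^ (-γ) := by
  obtain ⟨C, hC⟩ := hgb
  have hC' : ∀ x, u₀ ≤ x → x ^ γ * |g x| ≤ C := fun x hx => hC ⟨⟨x, hx⟩, rfl⟩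
  refine ⟨C, le_trans (by positivity) (hC' u₀ le_rfl), fun x hx => ?_⟩
  have hx0 : 0 < x := hu₀.trans_le hx
  have hxg : 0 < x ^ γ := Real.rpow_pos_of_pos hx0 γ
  rw [Real.rpow_neg hx0.le, ← div_eq_mul_inv, le_div_iff₀ hxg, mul_comm]
  exact hC' x hx

section Averaging

variable {Fbar g : ℝ → ℝ} {γ u₀ C : ℝ}

/-- Pointwise domination of the integrand of `∫₀^∞ g(t+z) F̄(z) dz`. -/
theorem abs_mul_tail_le (hγ : 0 < γ) (hu₀ : 0 < u₀) (hC : 0 ≤ C)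
    (hF_mem : ∀ y ∈ Set.Ici (0 : ℝ), Fbar y ∈ Set.Icc (0 : ℝ) 1)
    (hgC : ∀ x, u₀ ≤ x → |g x| ≤ C * x ^ (-γ)) {s t z : ℝ} (hs : u₀ ≤ s) (hst : s ≤ t)
    (hz : 0 < z) : ‖g (t + z) * Fbar z‖ ≤ C * s ^ (-γ) * Fbar z := by
  have hF : 0 ≤ Fbar z := (hF_mem z hz.le).1
  rw [norm_mul, Real.norm_eq_abs, Real.norm_eq_abs, abs_of_nonneg hF]
  refine mul_le_mul_of_nonneg_right ((hgC _ (by linarith)).trans ?_) hF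
  exact mul_le_mul_of_nonneg_left
    (Real.rpow_le_rpow_of_nonpos (hu₀.trans_le hs) (by linarith) (by linarith)) hC

/-- `t ↦ ∫₀^∞ g(t+z) F̄(z) dz` is continuous on `[u₀,∞)`. -/
theorem continuousOn_integral_tail (hγ : 0 < γ) (hu₀ : 0 < u₀) (hC : 0 ≤ C)
    (hF_mem : ∀ y ∈ Set.Ici (0 : ℝ), Fbar y ∈ Set.Icc (0 : ℝ) 1)
    (hF_int : IntegrableOn Fbar (Set.Ioi 0)) (hg : ContinuousOn g (Set.Ici u₀))
    (hgC : ∀ x, u₀ ≤ x → |g x| ≤ C * x ^ (-γ)) :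
    ContinuousOn (fun t => ∫ z in Set.Ioi (0 : ℝ), g (t + z) * Fbar z) (Set.Ici u₀) := by
  refine continuousOn_of_dominated (bound := fun z => C * u₀ ^ (-γ) * Fbar z)
    (fun t ht => ?_) (fun t ht => ?_) (hF_int.const_mul _) ?_
  · refine AEStronglyMeasurable.mul ?_ hF_int.aestronglyMeasurable
    refine ContinuousOn.aestronglyMeasurable ?_ measurableSet_Ioi
    refine hg.comp (by fun_prop) fun z hz => ?_
    simp only [Set.mem_Ioi, Set.mem_Ici] at *
    linarith
  · filter_upwards [ae_restrict_mem measurableSet_Ioi] with z hz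
    exact abs_mul_tail_le hγ hu₀ hC hF_mem hgC le_rfl ht hz
  · filter_upwards [ae_restrict_mem measurableSet_Ioi] with z hz
    refine ContinuousOn.mul (hg.comp (by fun_prop) fun t ht => ?_) continuousOn_const
    simp only [Set.mem_Ioi, Set.mem_Ici] at *
    linarith

/-- `|∫₀^∞ g(t+z) F̄(z) dz| ≤ C t^{-γ} ∫₀^∞ F̄`. -/
theorem norm_integral_tail_le (hγ : 0 < γ) (hu₀ : 0 < u₀) (hC : 0 ≤ C)
    (hF_mem : ∀ y ∈ Set.Ici (0 : ℝ), Fbar y ∈ Set.Icc (0 : ℝ) 1)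
    (hF_int : IntegrableOn Fbar (Set.Ioi 0))
    (hgC : ∀ x, u₀ ≤ x → |g x| ≤ C * x ^ (-γ)) {t : ℝ} (ht : u₀ ≤ t) :
    ‖∫ z in Set.Ioi (0 : ℝ), g (t + z) * Fbar z‖
      ≤ C * t ^ (-γ) * ∫ z in Set.Ioi (0 : ℝ), Fbar z := by
  rw [← integral_const_mul]
  refine norm_integral_le_of_norm_le (hF_int.const_mul _) ?_
  filter_upwards [ae_restrict_mem measurableSet_Ioi] with z hz
  exact abs_mul_tail_le hγ hu₀ hC hF_mem hgC ht le_rfl hz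

end Averaging

/-- A weight `t^{γ-2} e^{α/t}` makes a continuous function of size `O(t^{-γ})` integrable. -/
theorem integrableOn_weight_mul {α γ u₀ K : ℝ} (hα : 0 < α) (hu₀ : 0 < u₀) {h : ℝ → ℝ}
    (hh : ContinuousOn h (Set.Ici u₀)) (hK : ∀ t, u₀ ≤ t → ‖h t‖ ≤ K * t ^ (-γ)) :
    ContinuousOn (fun t => t ^ (γ - 2) * Real.exp (α / t) * h t) (Set.Ici u₀) ∧
    IntegrableOn (fun t => t ^ (γ - 2) * Real.exp (α / t) * h t) (Set.Ioi u₀) := by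
  have hcont : ContinuousOn (fun t => t ^ (γ - 2) * Real.exp (α / t) * h t) (Set.Ici u₀) := by
    have h0 : ∀ t ∈ Set.Ici u₀, t ≠ 0 := fun t ht => (hu₀.trans_le ht).ne'
    refine ContinuousOn.mul (ContinuousOn.mul ?_ ?_) hh
    · exact continuousOn_id.rpow_const fun t ht => Or.inl (h0 t ht)
    · exact (continuousOn_const.div continuousOn_id h0).rexp
  refine ⟨hcont, ?_⟩
  refine Integrable.mono'
    ((integrableOn_Ioi_rpow_of_lt (show (-2 : ℝ) < -1 by norm_num) hu₀).const_mul
      (Real.exp (α / u₀) * K))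
    ((hcont.mono Set.Ioi_subset_Ici_self).aestronglyMeasurable measurableSet_Ioi) ?_
  filter_upwards [ae_restrict_mem measurableSet_Ioi] with t ht
  have ht' : u₀ < t := ht
  have ht0 : 0 < t := hu₀.trans ht'
  have hw : 0 < t ^ (γ - 2) := Real.rpow_pos_of_pos ht0 _
  rw [norm_mul, Real.norm_of_nonneg (by positivity)]
  have hexp : Real.exp (α / t) ≤ Real.exp (α / u₀) :=
    Real.exp_le_exp.2 (div_le_div_of_nonneg_left hα.le hu₀ ht'.le)
  calc t ^ (γ - 2) * Real.exp (α / t) * ‖h t‖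
      ≤ t ^ (γ - 2) * Real.exp (α / u₀) * (K * t ^ (-γ)) := by
        gcongr
        exact hK t ht'.le
    _ = Real.exp (α / u₀) * K * (t ^ (γ - 2) * t ^ (-γ)) := by ring
    _ = Real.exp (α / u₀) * K * t ^ (-2 : ℝ) := by
        rw [← Real.rpow_add ht0]
        ring_nf

/-- Fundamental theorem of calculus for `u ↦ ∫_u^∞ φ`. -/
theorem hasDerivAt_integral_Ioi {φ : ℝ → ℝ} {u₀ u : ℝ} (hφ : ContinuousOn φ (Set.Ici u₀))
    (hint : IntegrableOn φ (Set.Ioi u₀)) (hu : u₀ < u) :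
    HasDerivAt (fun x => ∫ t in Set.Ioi x, φ t) (-φ u) u := by
  have hFTC : HasDerivAt (fun x => ∫ t in u₀..x, φ t) (φ u) u := by
    refine intervalIntegral.integral_hasDerivAt_right ?_ ?_ ?_
    · exact (intervalIntegrable_iff_integrableOn_Ioc_of_le hu.le).2
        (hint.mono_set Set.Ioc_subset_Ioi_self)
    · exact (hφ.mono Set.Ioi_subset_Ici_self).stronglyMeasurableAtFilter isOpen_Ioi u hu
    · exact hφ.continuousAt (Ici_mem_nhds hu)
  refine (hFTC.const_sub (∫ t in Set.Ioi u₀, φ t)).congr_of_eventuallyEq ?_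
  filter_upwards [Ioi_mem_nhds hu] with x hx
  have hx' : u₀ < x := hx
  rw [← intervalIntegral.integral_Ioi_sub_Ioi hint hx'.le]
  ring

/-- The integrating factor `u^{-γ} e^{-α/u}` solves `u² y' + (γ u - α) y = 0`. -/
theorem hasDerivAt_rpow_mul_exp (α γ : ℝ) {u : ℝ} (hu : 0 < u) :
    HasDerivAt (fun x : ℝ => x ^ (-γ) * Real.exp (-(α / x)))
      (-((γ * u - α) * (u ^ (-γ) * Real.exp (-(α / u)))) / u ^ 2) u := by
  have h1 : HasDerivAt (fun x : ℝ => x ^ (-γ)) (-γ * u ^ (-γ - 1)) u :=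
    Real.hasDerivAt_rpow_const (Or.inl hu.ne')
  have h2 := (((hasDerivAt_inv hu.ne').const_mul α).neg).exp
  simp only [← div_eq_mul_inv] at h2
  refine (h1.mul h2).congr_deriv ?_
  rw [Real.rpow_sub_one hu.ne']
  simp only [Pi.neg_apply]
  field_simp
  ring

theorem stmt6
    (Fbar : ℝ → ℝ) (μ α γ m : ℝ)
    (hμ : 0 < μ) (hα : 0 < α) (hγ : 0 < γ)
    (hF_anti : AntitoneOn Fbar (Set.Ici 0))
    (hF_mem : ∀ y ∈ Set.Ici (0 : ℝ), Fbar y ∈ Set.Icc (0 : ℝ) 1)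
    (hF_int : IntegrableOn Fbar (Set.Ioi 0))
    (hm : m = ∫ z in Set.Ioi (0 : ℝ), Fbar z)
    (u₀ : ℝ) (hu₀ : 0 < u₀)
    (g : ℝ → ℝ)
    (hg : ContinuousOn g (Set.Ici u₀))
    (hgb : BddAbove (Set.range fun x : {x : ℝ // u₀ ≤ x} => (x : ℝ) ^ γ * |g x|))
    (hfix : ∀ u ∈ Set.Ici u₀, g u = u ^ (-γ) * Real.exp (-(α / u)) + opT μ α γ Fbar g u) :
    (∀ u ∈ Set.Ioi u₀, DifferentiableAt ℝ g u) ∧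
    ContinuousOn (deriv g) (Set.Ioi u₀) ∧
    (∀ u ∈ Set.Ioi u₀, u ^ 2 * deriv g u + (γ * u - α) * g u = -opA μ Fbar g u) := by
  obtain ⟨C, hC, hgC⟩ := exists_abs_le_rpow_neg hu₀ hgb
  set h : ℝ → ℝ := fun t => ∫ z in Set.Ioi (0 : ℝ), g (t + z) * Fbar z with h_def
  have hh : ContinuousOn h (Set.Ici u₀) :=
    continuousOn_integral_tail hγ hu₀ hC hF_mem hF_int hg hgC
  obtain ⟨hφ, hint⟩ := integrableOn_weight_mul (γ := γ)
    (K := C * ∫ z in Set.Ioi (0 : ℝ), Fbar z) hα hu₀ hh fun t ht => by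
      rw [mul_right_comm]
      exact norm_integral_tail_le hγ hu₀ hC hF_mem hF_int hgC ht
  have hderiv : ∀ u ∈ Set.Ioi u₀,
      HasDerivAt g ((-((γ * u - α) * g u) - μ * h u) / u ^ 2) u := by
    intro u hu
    have hu' : u₀ < u := hu
    have hu0 : 0 < u := hu₀.trans hu'
    have hw := hasDerivAt_rpow_mul_exp α γ hu0
    have hI := hasDerivAt_integral_Ioi hφ hint hu'
    have heq : ∀ x, u₀ ≤ x → g x = x ^ (-γ) * Real.exp (-(α / x)) *
        (1 + μ * ∫ t in Set.Ioi x, t ^ (γ - 2) * Real.exp (α / t) * h t) := by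
      intro x hx
      rw [hfix x hx, opT]
      ring
    have hprod := (hw.mul ((hI.const_mul μ).const_add 1)).congr_of_eventuallyEq
      (f₁ := g) (by filter_upwards [Ioi_mem_nhds hu'] with x hx using heq x (le_of_lt hx))
    refine hprod.congr_deriv ?_
    have hcancel : u ^ (-γ) * Real.exp (-(α / u)) * (u ^ (γ - 2) * Real.exp (α / u))
        = 1 / u ^ 2 := by
      rw [mul_mul_mul_comm, ← Real.rpow_add hu0, ← Real.exp_add, neg_add_cancel, Real.exp_zero,
        show -γ + (γ - 2) = -(2 : ℕ) by push_cast; ring, Real.rpow_neg hu0.le,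
        Real.rpow_natCast]
      simp
    rw [heq u hu'.le]
    linear_combination (-(μ * h u)) * hcancel
  refine ⟨fun u hu => (hderiv u hu).differentiableAt, ?_, fun u hu => ?_⟩
  · refine ContinuousOn.congr (f := fun u => (-((γ * u - α) * g u) - μ * h u) / u ^ 2) ?_
      fun u hu => (hderiv u hu).deriv
    have hg' := hg.mono (Set.Ioi_subset_Ici_self (a := u₀))
    have hh' := hh.mono (Set.Ioi_subset_Ici_self (a := u₀))
    refine ContinuousOn.div (by fun_prop) (by fun_prop) fun u hu => ?_
    exact pow_ne_zero 2 (hu₀.trans hu).ne'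
  · have hu0 : u ≠ 0 := (hu₀.trans hu).ne'
    rw [(hderiv u hu).deriv, opA, mul_div_cancel₀ _ (pow_ne_zero 2 hu0)]
    ring
end

section
/- Let γ > 0, u₀ > 0, and let g be continuous on [u₀,∞), continuously differentiable on (u₀,∞), with ‖g‖_{γ,u₀} < ∞, satisfying u² g'(u) + (γ u − α) g(u) = −A g(u) for all u > u₀ and u^γ e^{α/u} g(u) → 1 as u → ∞. Then g satisfies the integral equation g(u) = u^{−γ} e^{−α/u} + μ u^{−γ} e^{−α/u} ∫_u^∞ t^{γ−2} e^{α/t} (∫₀^∞ g(t+z) F̄(z) dz) dt for all u ≥ u₀. -/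
open MeasureTheory Set Filter Topology

/-- The integrating factor `u^γ e^{α/u}` turns `u² g' + (γ u - α) g` into a derivative. -/
theorem hasDerivAt_rpow_mul_exp_mul {α γ u g' : ℝ} {g : ℝ → ℝ} (hu : 0 < u)
    (hg : HasDerivAt g g' u) :
    HasDerivAt (fun u => u ^ γ * Real.exp (α / u) * g u)
      (u ^ (γ - 2) * Real.exp (α / u) * (u ^ 2 * g' + (γ * u - α) * g u)) u := by
  have h1 : HasDerivAt (fun x : ℝ => x ^ γ) (γ * u ^ (γ - 1)) u :=
    Real.hasDerivAt_rpow_const (Or.inl hu.ne')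
  have h2 : HasDerivAt (fun x : ℝ => α / x) (-α / u ^ 2) u := by
    simpa using (hasDerivAt_const u α).fun_div (hasDerivAt_id' u) hu.ne'
  refine ((h1.fun_mul h2.exp).fun_mul hg).congr_deriv ?_
  have e1 : u ^ (γ - 1) = u ^ (γ - 2) * u := by
    rw [← Real.rpow_add_one hu.ne']
    ring_nf
  have e2 : u ^ γ = u ^ (γ - 2) * u ^ 2 := by
    rw [← Real.rpow_natCast, ← Real.rpow_add hu]
    norm_num
  rw [e1, e2]
  field_simp
  ring

/-- A function bounded by `C x^{-γ}` on `[u₀, ∞)` has integrals against its translates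
bounded by the same power. -/
theorem abs_integral_add_mul_le {γ u₀ C t : ℝ} {Fbar g : ℝ → ℝ} (hγ : 0 < γ) (hu₀ : 0 < u₀)
    (hF_nonneg : ∀ y ∈ Ioi (0 : ℝ), 0 ≤ Fbar y) (hF_int : IntegrableOn Fbar (Ioi 0))
    (hC : ∀ x, u₀ ≤ x → x ^ γ * |g x| ≤ C) (ht : u₀ ≤ t) :
    |∫ z in Ioi (0 : ℝ), g (t + z) * Fbar z| ≤ C * t ^ (-γ) * ∫ z in Ioi (0 : ℝ), Fbar z := by
  have ht0 : 0 < t := hu₀.trans_le ht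
  rw [← Real.norm_eq_abs, ← integral_const_mul]
  refine norm_integral_le_of_norm_le (hF_int.const_mul _) ?_
  filter_upwards [ae_restrict_mem measurableSet_Ioi] with z hz
  have hz0 : 0 < z := hz
  rw [norm_mul, Real.norm_eq_abs, Real.norm_eq_abs, abs_of_nonneg (hF_nonneg z hz)]
  refine mul_le_mul_of_nonneg_right ?_ (hF_nonneg z hz)
  have htγ : 0 < t ^ γ := Real.rpow_pos_of_pos ht0 γ
  rw [Real.rpow_neg ht0.le, ← div_eq_mul_inv, le_div_iff₀ htγ, mul_comm]
  calc t ^ γ * |g (t + z)| ≤ (t + z) ^ γ * |g (t + z)| := by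
        gcongr
        linarith
    _ ≤ C := hC _ (by linarith)

theorem stmt7
    (Fbar : ℝ → ℝ) (μ α γ m : ℝ)
    (hμ : 0 < μ) (hα : 0 < α) (hγ : 0 < γ)
    (hF_anti : AntitoneOn Fbar (Set.Ici 0))
    (hF_mem : ∀ y ∈ Set.Ici (0 : ℝ), Fbar y ∈ Set.Icc (0 : ℝ) 1)
    (hF_int : IntegrableOn Fbar (Set.Ioi 0))
    (hm : m = ∫ z in Set.Ioi (0 : ℝ), Fbar z)
    (u₀ : ℝ) (hu₀ : 0 < u₀)
    (g : ℝ → ℝ)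
    (hg : ContinuousOn g (Set.Ici u₀))
    (hg' : ∀ u ∈ Set.Ioi u₀, DifferentiableAt ℝ g u)
    (hg'c : ContinuousOn (deriv g) (Set.Ioi u₀))
    (hgb : BddAbove (Set.range fun x : {x : ℝ // u₀ ≤ x} => (x : ℝ) ^ γ * |g x|))
    (hIDE : ∀ u ∈ Set.Ioi u₀, u ^ 2 * deriv g u + (γ * u - α) * g u = -opA μ Fbar g u)
    (hlim : Tendsto (fun u => u ^ γ * Real.exp (α / u) * g u) atTop (nhds 1)) :
    ∀ u ∈ Set.Ici u₀, g u = u ^ (-γ) * Real.exp (-(α / u)) + opT μ α γ Fbar g u := by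
  intro u hu
  have hu' : u₀ ≤ u := hu
  have hu0 : 0 < u := hu₀.trans_le hu'
  obtain ⟨C, hC⟩ := hgb
  replace hC : ∀ x, u₀ ≤ x → x ^ γ * |g x| ≤ C := fun x hx => hC ⟨⟨x, hx⟩, rfl⟩
  have hF_nonneg : ∀ y ∈ Ioi (0 : ℝ), 0 ≤ Fbar y := fun y hy =>
    (hF_mem y (Ioi_subset_Ici_self hy)).1
  have hIoi : Ioi u ⊆ Ioi u₀ := Ioi_subset_Ioi hu'
  set G : ℝ → ℝ := fun t => ∫ z in Ioi (0 : ℝ), g (t + z) * Fbar z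
  have hIDE' : ∀ t ∈ Ioi u, t ^ (γ - 2) * Real.exp (α / t) * (t ^ 2 * deriv g t
      + (γ * t - α) * g t) = -μ * (t ^ (γ - 2) * Real.exp (α / t) * G t) := by
    intro t ht
    rw [hIDE t (hIoi ht), opA]
    ring
  have hderiv : ∀ t ∈ Ioi u, HasDerivAt (fun u => u ^ γ * Real.exp (α / u) * g u)
      (-μ * (t ^ (γ - 2) * Real.exp (α / t) * G t)) t := by
    intro t ht
    rw [← hIDE' t ht]
    exact hasDerivAt_rpow_mul_exp_mul (hu0.trans ht) (hg' t (hIoi ht)).hasDerivAt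
  have hcont : ContinuousWithinAt (fun u => u ^ γ * Real.exp (α / u) * g u) (Ici u) u := by
    refine ContinuousWithinAt.mul (ContinuousAt.continuousWithinAt ?_)
      ((hg u hu).mono (Ici_subset_Ici.2 hu'))
    exact (Real.continuousAt_rpow_const _ _ (Or.inl hu0.ne')).mul
      (Real.continuous_exp.continuousAt.comp (continuousAt_const.div continuousAt_id hu0.ne'))
  have hmeas : AEStronglyMeasurable (fun t => -μ * (t ^ (γ - 2) * Real.exp (α / t) * G t))
      (volume.restrict (Ioi u)) := by
    refine (ContinuousOn.congr ?_ fun t ht => (hIDE' t ht).symm).aestronglyMeasurable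
      measurableSet_Ioi
    have hne : ∀ t ∈ Ioi u, t ≠ 0 := fun t ht => (hu0.trans ht).ne'
    have hg1 : ContinuousOn g (Ioi u) := hg.mono (hIoi.trans Ioi_subset_Ici_self)
    have hg2 : ContinuousOn (deriv g) (Ioi u) := hg'c.mono hIoi
    refine ContinuousOn.mul (ContinuousOn.mul ?_ ?_) ?_
    · exact continuousOn_id.rpow_const fun t ht => Or.inl (hne t ht)
    · exact (continuousOn_const.div continuousOn_id hne).rexp
    · fun_prop
  have hint : IntegrableOn (fun t => -μ * (t ^ (γ - 2) * Real.exp (α / t) * G t)) (Ioi u) := by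
    refine Integrable.mono' ((integrableOn_Ioi_rpow_of_lt (a := -2) (by norm_num) hu0).const_mul
      (μ * (Real.exp (α / u) * (C * m)))) hmeas ?_
    filter_upwards [ae_restrict_mem measurableSet_Ioi] with t ht
    have ht' : u < t := ht
    have ht0 : 0 < t := hu0.trans ht
    have hGt : |G t| ≤ C * t ^ (-γ) * m :=
      hm ▸ abs_integral_add_mul_le hγ hu₀ hF_nonneg hF_int hC (hu'.trans ht'.le)
    have e : t ^ (-2 : ℝ) = t ^ (γ - 2) * t ^ (-γ) := by
      rw [← Real.rpow_add ht0]
      ring_nf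
    rw [Real.norm_eq_abs, abs_mul, abs_neg, abs_of_pos hμ, abs_mul, abs_of_pos (by positivity), e]
    calc μ * (t ^ (γ - 2) * Real.exp (α / t) * |G t|)
        ≤ μ * (t ^ (γ - 2) * Real.exp (α / u) * (C * t ^ (-γ) * m)) := by gcongr
      _ = μ * (Real.exp (α / u) * (C * m)) * (t ^ (γ - 2) * t ^ (-γ)) := by ring
  have key := integral_Ioi_of_hasDerivAt_of_tendsto hcont hderiv hint hlim
  rw [integral_const_mul] at key
  have hinv : u ^ (-γ) * Real.exp (-(α / u)) * (u ^ γ * Real.exp (α / u)) = 1 := by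
    rw [Real.rpow_neg hu0.le, Real.exp_neg]
    have := Real.rpow_pos_of_pos hu0 γ
    field_simp
  rw [opT]
  linear_combination (-(g u)) * hinv + u ^ (-γ) * Real.exp (-(α / u)) * key
end

section
/- Let α > 0, γ ∈ ℝ, u₀ > 0, and set M(u) := u^γ e^{α/u} for u > 0. Then M(u) → ∞ as u ↓ 0, and for any continuous function H : [0,u₀] → ℝ one has lim_{u↓0} (1/M(u)) ∫_u^{u₀} t^{γ−2} e^{α/t} H(t) dt = H(0)/α. In particular, for any constant c₀, the function f(u) := (M(u₀)/M(u)) c₀ + (1/M(u)) ∫_u^{u₀} t^{γ−2} e^{α/t} H(t) dt extends to a continuous function on [0,u₀] with f(0) = H(0)/α. -/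
open MeasureTheory Set Filter Topology

/-- `u ^ γ * exp (α / u)` tends to infinity at `0` from the right. -/
theorem tendsto_rpow_mul_exp_div_nhdsGT_zero {α : ℝ} (hα : 0 < α) (γ : ℝ) :
    Tendsto (fun u : ℝ => u ^ γ * Real.exp (α / u)) (𝓝[>] 0) atTop := by
  refine ((tendsto_exp_mul_div_rpow_atTop γ α hα).comp tendsto_inv_nhdsGT_zero).congr' ?_
  filter_upwards [self_mem_nhdsWithin] with u hu
  have hu' : (0 : ℝ) < u := hu
  simp only [Function.comp_apply]
  rw [Real.inv_rpow hu'.le, div_inv_eq_mul, mul_comm, div_eq_mul_inv]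

theorem hasDerivAt_rpow_mul_exp_div (α γ : ℝ) {t : ℝ} (ht : 0 < t) :
    HasDerivAt (fun u : ℝ => u ^ γ * Real.exp (α / u))
      (-(t ^ (γ - 2) * Real.exp (α / t) * (α - γ * t))) t := by
  have h₁ : HasDerivAt (fun u : ℝ => u ^ γ) (γ * t ^ (γ - 1)) t :=
    Real.hasDerivAt_rpow_const (Or.inl ht.ne')
  have h₂ : HasDerivAt (fun u : ℝ => Real.exp (α / u))
      (Real.exp (α / t) * (α * (-(t ^ 2)⁻¹))) t := by
    simpa only [div_eq_mul_inv] using ((hasDerivAt_inv ht.ne').const_mul α).exp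
  refine (h₁.mul h₂).congr_deriv ?_
  have e₁ : t ^ (γ - 1) = t ^ (γ - 2) * t := by
    rw [← Real.rpow_add_one ht.ne']; ring_nf
  have e₂ : t ^ γ = t ^ (γ - 2) * t ^ 2 := by
    rw [← Real.rpow_natCast, ← Real.rpow_add ht]; norm_num
  rw [e₁, e₂]
  field_simp
  ring

theorem continuousOn_rpow_mul_exp_div (α γ : ℝ) :
    ContinuousOn (fun t : ℝ => t ^ γ * Real.exp (α / t)) (Ioi 0) := by
  intro t ht
  exact (hasDerivAt_rpow_mul_exp_div α γ ht).continuousAt.continuousWithinAt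

theorem intervalIntegrable_rpow_mul_exp_div_mul {α γ a b c : ℝ} {H : ℝ → ℝ}
    (hH : ContinuousOn H (Icc 0 c)) (ha : 0 < a) (hab : a ≤ b) (hbc : b ≤ c) :
    IntervalIntegrable (fun t => t ^ (γ - 2) * Real.exp (α / t) * H t) volume a b := by
  apply ContinuousOn.intervalIntegrable
  rw [uIcc_of_le hab]
  refine ((continuousOn_rpow_mul_exp_div α (γ - 2)).mono fun t ht => ?_).mul (hH.mono ?_)
  · exact ha.trans_le ht.1
  · exact Icc_subset_Icc ha.le hbc

theorem integral_rpow_mul_exp_div_mul_sub (α γ : ℝ) {a b : ℝ} (ha : 0 < a) (hab : a ≤ b) :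
    ∫ t in a..b, t ^ (γ - 2) * Real.exp (α / t) * (α - γ * t) =
      a ^ γ * Real.exp (α / a) - b ^ γ * Real.exp (α / b) := by
  have h := intervalIntegral.integral_eq_sub_of_hasDerivAt (a := a) (b := b)
    (f := fun u : ℝ => -(u ^ γ * Real.exp (α / u)))
    (f' := fun t => t ^ (γ - 2) * Real.exp (α / t) * (α - γ * t)) (fun t ht => ?_)
    (intervalIntegrable_rpow_mul_exp_div_mul (by fun_prop) ha hab le_rfl)
  · rw [h]; ring
  · rw [uIcc_of_le hab] at ht
    exact (hasDerivAt_rpow_mul_exp_div α γ (ha.trans_le ht.1)).neg.congr_deriv (neg_neg _)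

/-- The weighted average vanishes at `0` when the continuous function does. -/
theorem tendsto_inv_mul_integral_of_zero {α γ c : ℝ} (hα : 0 < α) (hc : 0 < c) {R : ℝ → ℝ}
    (hR : ContinuousOn R (Icc 0 c)) (hR₀ : R 0 = 0) :
    Tendsto (fun u : ℝ => (u ^ γ * Real.exp (α / u))⁻¹ *
      ∫ t in u..c, t ^ (γ - 2) * Real.exp (α / t) * R t) (𝓝[>] 0) (𝓝 0) := by
  rw [Metric.tendsto_nhds]
  intro ε hε
  have hsmall : ∀ᶠ t in 𝓝[Icc 0 c] 0, |R t| < ε / 2 * (α - γ * t) := by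
    have h₁ : Tendsto (fun t => |R t|) (𝓝[Icc 0 c] 0) (𝓝 0) := by
      have := (hR 0 ⟨le_rfl, hc.le⟩).abs
      simpa [ContinuousWithinAt, hR₀] using this
    have h₂ : Tendsto (fun t => ε / 2 * (α - γ * t)) (𝓝[Icc 0 c] 0) (𝓝 (ε / 2 * α)) := by
      have : ContinuousWithinAt (fun t : ℝ => ε / 2 * (α - γ * t)) (Icc 0 c) 0 := by fun_prop
      simpa [ContinuousWithinAt] using this
    exact h₁.eventually_lt h₂ (by positivity)
  obtain ⟨η, hη, hη'⟩ := Metric.mem_nhdsWithin_iff.1 hsmall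
  set δ := min (η / 2) c with hδ
  have hδ₀ : 0 < δ := lt_min (half_pos hη) hc
  have hδc : δ ≤ c := min_le_right _ _
  have hbound : ∀ t, 0 ≤ t → t ≤ δ → |R t| ≤ ε / 2 * (α - γ * t) := fun t h₀ h₁ => by
    refine (hη' ⟨?_, h₀, h₁.trans hδc⟩).le
    rw [Metric.mem_ball, Real.dist_eq, sub_zero, abs_of_nonneg h₀]
    linarith [min_le_left (η / 2) c]
  have hM := tendsto_rpow_mul_exp_div_nhdsGT_zero hα γ
  set C := ∫ t in δ..c, t ^ (γ - 2) * Real.exp (α / t) * R t with hC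
  have hC₀ := hM.eventually_gt_atTop (2 * |C| / ε)
  filter_upwards [hC₀, Ioo_mem_nhdsGT hδ₀] with u huC hu
  have hMu : 0 < u ^ γ * Real.exp (α / u) := mul_pos (Real.rpow_pos_of_pos hu.1 _) (Real.exp_pos _)
  have hMδ : 0 < δ ^ γ * Real.exp (α / δ) := mul_pos (Real.rpow_pos_of_pos hδ₀ _) (Real.exp_pos _)
  have hnear : |∫ t in u..δ, t ^ (γ - 2) * Real.exp (α / t) * R t| ≤
      ε / 2 * (u ^ γ * Real.exp (α / u) - δ ^ γ * Real.exp (α / δ)) := by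
    rw [← integral_rpow_mul_exp_div_mul_sub α γ hu.1 hu.2.le,
      ← intervalIntegral.integral_const_mul, ← Real.norm_eq_abs]
    refine intervalIntegral.norm_integral_le_of_norm_le hu.2.le
      (Eventually.of_forall fun t ht => ?_)
      ((intervalIntegrable_rpow_mul_exp_div_mul (by fun_prop) hu.1 hu.2.le le_rfl).const_mul _)
    have ht₀ : 0 < t := hu.1.trans ht.1
    have hw : 0 < t ^ (γ - 2) * Real.exp (α / t) :=
      mul_pos (Real.rpow_pos_of_pos ht₀ _) (Real.exp_pos _)
    rw [Real.norm_eq_abs, abs_mul, abs_of_pos hw]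
    have := mul_le_mul_of_nonneg_left (hbound t ht₀.le ht.2) hw.le
    linarith
  rw [← intervalIntegral.integral_add_adjacent_intervals
    (intervalIntegrable_rpow_mul_exp_div_mul hR hu.1 hu.2.le hδc)
    (intervalIntegrable_rpow_mul_exp_div_mul hR hδ₀ hδc le_rfl), ← hC, Real.dist_eq, sub_zero,
    abs_mul, abs_inv, abs_of_pos hMu, inv_mul_lt_iff₀ hMu]
  rw [div_lt_iff₀ hε] at huC
  have hεδ := mul_pos hε hMδ
  refine (abs_add_le _ _).trans_lt ?_
  linarith

theorem tendsto_inv_mul_integral {α γ c : ℝ} (hα : 0 < α) (hc : 0 < c) {H : ℝ → ℝ}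
    (hH : ContinuousOn H (Icc 0 c)) :
    Tendsto (fun u : ℝ => (u ^ γ * Real.exp (α / u))⁻¹ *
      ∫ t in u..c, t ^ (γ - 2) * Real.exp (α / t) * H t) (𝓝[>] 0) (𝓝 (H 0 / α)) := by
  set L := H 0 / α with hL
  have hR : ContinuousOn (fun t => H t - L * (α - γ * t)) (Icc 0 c) := hH.sub (by fun_prop)
  have hlim := tendsto_inv_mul_integral_of_zero (γ := γ) hα hc hR (by
    rw [hL]; field_simp; ring)
  have hMinv := (tendsto_rpow_mul_exp_div_nhdsGT_zero hα γ).inv_tendsto_atTop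
  have hsum := (hlim.add_const L).sub (hMinv.mul_const (L * (c ^ γ * Real.exp (α / c))))
  rw [zero_add, zero_mul, sub_zero] at hsum
  refine hsum.congr' ?_
  filter_upwards [Ioo_mem_nhdsGT hc] with u hu
  have hMu : u ^ γ * Real.exp (α / u) ≠ 0 :=
    (mul_pos (Real.rpow_pos_of_pos hu.1 _) (Real.exp_pos _)).ne'
  have hsplit : ∫ t in u..c, t ^ (γ - 2) * Real.exp (α / t) * H t =
      (∫ t in u..c, t ^ (γ - 2) * Real.exp (α / t) * (H t - L * (α - γ * t))) +
        L * (u ^ γ * Real.exp (α / u) - c ^ γ * Real.exp (α / c)) := by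
    rw [← integral_rpow_mul_exp_div_mul_sub α γ hu.1 hu.2.le,
      ← intervalIntegral.integral_const_mul, ← intervalIntegral.integral_add
        (intervalIntegrable_rpow_mul_exp_div_mul hR hu.1 hu.2.le le_rfl)
        ((intervalIntegrable_rpow_mul_exp_div_mul (by fun_prop) hu.1 hu.2.le le_rfl).const_mul _)]
    congr 1 with t
    ring
  rw [hsplit, Pi.inv_apply]
  generalize (∫ t in u..c, t ^ (γ - 2) * Real.exp (α / t) * (H t - L * (α - γ * t))) = J
  generalize u ^ γ * Real.exp (α / u) = m at hMu ⊢
  field_simp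
  ring

theorem continuousOn_integral_rpow_mul_exp_div_mul (α γ : ℝ) {c : ℝ} {H : ℝ → ℝ}
    (hH : ContinuousOn H (Icc 0 c)) :
    ContinuousOn (fun u => ∫ t in u..c, t ^ (γ - 2) * Real.exp (α / t) * H t) (Ioc 0 c) := by
  intro u hu
  have hu₂ : 0 < u / 2 := half_pos hu.1
  have huc : u / 2 ≤ c := (half_le_self hu.1.le).trans hu.2
  have hii := intervalIntegrable_rpow_mul_exp_div_mul (α := α) (γ := γ) hH hu₂ huc le_rfl
  have hcont := intervalIntegral.continuousOn_primitive_interval_left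
    ((uIcc_of_le huc).symm ▸ (intervalIntegrable_iff_integrableOn_Icc_of_le huc).1 hii)
  rw [uIcc_of_le huc] at hcont
  refine (hcont u ⟨half_le_self hu.1.le, hu.2⟩).mono_of_mem_nhdsWithin ?_
  filter_upwards [self_mem_nhdsWithin, mem_nhdsWithin_of_mem_nhds
    (Ioi_mem_nhds (half_lt_self hu.1))] with t ht ht'
  exact ⟨le_of_lt ht', ht.2⟩

theorem stmt11
    (α γ u₀ : ℝ) (hα : 0 < α) (hu₀ : 0 < u₀)
    (H : ℝ → ℝ) (hH : ContinuousOn H (Set.Icc 0 u₀)) (c₀ : ℝ) :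
    -- M(u) → ∞ as u ↓ 0:
    Tendsto (fun u : ℝ => u ^ γ * Real.exp (α / u)) (nhdsWithin 0 (Set.Ioi 0)) atTop ∧
    -- (1/M(u)) ∫_u^{u₀} t^{γ-2} e^{α/t} H(t) dt → H(0)/α as u ↓ 0:
    Tendsto (fun u : ℝ => (u ^ γ * Real.exp (α / u))⁻¹ *
        ∫ t in u..u₀, t ^ (γ - 2) * Real.exp (α / t) * H t)
      (nhdsWithin 0 (Set.Ioi 0)) (nhds (H 0 / α)) ∧
    -- f extends continuously to [0,u₀] with f(0) = H(0)/α: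
    ∃ fext : ℝ → ℝ, ContinuousOn fext (Set.Icc 0 u₀) ∧ fext 0 = H 0 / α ∧
      ∀ u ∈ Set.Ioc (0 : ℝ) u₀,
        fext u = (u₀ ^ γ * Real.exp (α / u₀)) / (u ^ γ * Real.exp (α / u)) * c₀ +
          (u ^ γ * Real.exp (α / u))⁻¹ *
            ∫ t in u..u₀, t ^ (γ - 2) * Real.exp (α / t) * H t := by
  have hM := tendsto_rpow_mul_exp_div_nhdsGT_zero hα γ
  have hlim := tendsto_inv_mul_integral (γ := γ) hα hu₀ hH
  refine ⟨hM, hlim, Function.update (fun u : ℝ =>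
    (u₀ ^ γ * Real.exp (α / u₀)) / (u ^ γ * Real.exp (α / u)) * c₀ +
      (u ^ γ * Real.exp (α / u))⁻¹ *
        ∫ t in u..u₀, t ^ (γ - 2) * Real.exp (α / t) * H t) 0 (H 0 / α), ?_,
    Function.update_self .., fun u hu => Function.update_of_ne hu.1.ne' ..⟩
  rw [continuousOn_update_iff, Icc_sdiff_left]
  refine ⟨?_, fun _ => ?_⟩
  · have hMc : ContinuousOn (fun u : ℝ => u ^ γ * Real.exp (α / u)) (Ioc 0 u₀) :=
      (continuousOn_rpow_mul_exp_div α γ).mono Ioc_subset_Ioi_self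
    have hM₀ : ∀ u ∈ Ioc 0 u₀, u ^ γ * Real.exp (α / u) ≠ 0 := fun u hu =>
      (mul_pos (Real.rpow_pos_of_pos hu.1 _) (Real.exp_pos _)).ne'
    exact ((continuousOn_const.div hMc hM₀).mul continuousOn_const).add
      ((hMc.inv₀ hM₀).mul (continuousOn_integral_rpow_mul_exp_div_mul α γ hH))
  · have h := ((hM.const_div_atTop (u₀ ^ γ * Real.exp (α / u₀))).mul_const c₀).add hlim
    rw [zero_mul, zero_add] at h
    exact h.mono_left (nhdsWithin_mono _ Ioc_subset_Ioi_self)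
end

section
/- Let α > 0, γ ∈ ℝ, u₀ > 0, M(u) := u^γ e^{α/u}, and define the kernel K(u,y) := (μ/M(u)) ∫_u^y t^{γ−2} e^{α/t} F̄(y−t) dt for 0 < u ≤ y ≤ u₀. Then for every fixed y ∈ (0,u₀], lim_{u↓0} K(u,y) = (μ/α) F̄(y−), where F̄(y−) denotes the left limit of F̄ at y. -/
open MeasureTheory Set Filter Topology Function

theorem image_inv_sub_Ioc {u y : ℝ} (hu : 0 < u) (huy : u < y) :
    (fun v : ℝ => (u⁻¹ - v)⁻¹) '' Ioc 0 (u⁻¹ - y⁻¹) = Ioc u y := by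
  have hy : 0 < y := hu.trans huy
  have hy' : 0 < y⁻¹ := inv_pos.2 hy
  ext t
  constructor
  · rintro ⟨v, ⟨hv0, hv1⟩, rfl⟩
    have h1 : 0 < u⁻¹ - v := by linarith
    exact ⟨(lt_inv_comm₀ hu h1).2 (by linarith), (inv_le_comm₀ h1 hy).2 (by linarith)⟩
  · rintro ⟨ht0, ht1⟩
    have ht : 0 < t := hu.trans ht0
    refine ⟨u⁻¹ - t⁻¹, ⟨sub_pos.2 ((inv_lt_inv₀ ht hu).2 ht0), ?_⟩, by simp⟩
    linarith [(inv_le_inv₀ hy ht).2 ht1]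

theorem integral_rpow_mul_exp_div_eq {u y : ℝ} (hu : 0 < u) (huy : u < y) (α γ : ℝ)
    (g : ℝ → ℝ) :
    1 / (u ^ γ * Real.exp (α / u)) * ∫ t in u..y, t ^ (γ - 2) * Real.exp (α / t) * g t =
      ∫ v in Ioc 0 (u⁻¹ - y⁻¹),
        ((u⁻¹ - v)⁻¹ / u) ^ γ * Real.exp (-α * v) * g (u⁻¹ - v)⁻¹ := by
  have hy' : 0 < y⁻¹ := inv_pos.2 (hu.trans huy)
  have hpos : ∀ v ∈ Ioc 0 (u⁻¹ - y⁻¹), 0 < u⁻¹ - v := fun v hv => by linarith [hv.2]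
  rw [intervalIntegral.integral_of_le huy.le, ← image_inv_sub_Ioc hu huy,
    integral_image_eq_integral_abs_deriv_smul (f' := fun v => ((u⁻¹ - v) ^ 2)⁻¹)
      measurableSet_Ioc, ← integral_const_mul]
  · refine setIntegral_congr_fun measurableSet_Ioc fun v hv => ?_
    have hw := hpos v hv
    have hψ : 0 < (u⁻¹ - v)⁻¹ := inv_pos.2 hw
    have hexp : Real.exp (α / (u⁻¹ - v)⁻¹) = Real.exp (α / u) * Real.exp (-α * v) := by
      rw [← Real.exp_add, div_inv_eq_mul]
      congr 1
      ring
    have hsq : ((u⁻¹ - v)⁻¹) ^ (γ - 2) = ((u⁻¹ - v)⁻¹) ^ γ * (u⁻¹ - v) ^ 2 := by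
      rw [Real.rpow_sub hψ, Real.rpow_two, inv_pow, div_inv_eq_mul]
    simp only [smul_eq_mul]
    rw [hexp, hsq, Real.div_rpow hψ.le hu.le, abs_of_pos (by positivity)]
    have := (Real.rpow_pos_of_pos hu γ).ne'
    have := (Real.exp_pos (α / u)).ne'
    have := hw.ne'
    generalize (u⁻¹ - v)⁻¹ ^ γ = A at *
    generalize g (u⁻¹ - v)⁻¹ = B at *
    generalize u⁻¹ - v = w at *
    field_simp
  · intro v hv
    have h := ((hasDerivAt_id' v).const_sub u⁻¹).fun_inv (hpos v hv).ne'
    rw [neg_neg, one_div] at h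
    exact h.hasDerivWithinAt
  · intro a _ b _ hab
    simpa using hab

theorem one_add_mul_rpow_le {y a : ℝ} (hy : 0 < y) (ha : 0 < a) (k : ℝ) (hk : 0 ≤ k) :
    ∃ C, ∀ v, 0 ≤ v → (1 + y * v) ^ k ≤ C * Real.exp (a * v) := by
  set ε := a / (k + 1) with hε
  have hε0 : 0 < ε := by positivity
  set D := max 1 (y / ε) with hD
  have hD1 : 1 ≤ D := le_max_left _ _
  have hDy : y ≤ D * ε := (div_le_iff₀ hε0).1 (le_max_right _ _)
  refine ⟨D ^ k, fun v hv => ?_⟩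
  have h1 : 1 + y * v ≤ D * Real.exp (ε * v) := by
    have := Real.add_one_le_exp (ε * v)
    nlinarith [mul_le_mul_of_nonneg_right hDy hv]
  calc (1 + y * v) ^ k ≤ (D * Real.exp (ε * v)) ^ k :=
        Real.rpow_le_rpow (by positivity) h1 hk
    _ = D ^ k * Real.exp (ε * v * k) := by
        rw [Real.mul_rpow (by positivity) (Real.exp_pos _).le, ← Real.exp_mul]
    _ ≤ D ^ k * Real.exp (a * v) := by
        have : ε * k ≤ a := by
          rw [hε, div_mul_eq_mul_div, div_le_iff₀ (by positivity)]
          nlinarith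
        rw [mul_right_comm]
        gcongr

theorem tendsto_inv_inv_sub (v : ℝ) :
    Tendsto (fun u : ℝ => (u⁻¹ - v)⁻¹) (𝓝[>] 0) (𝓝[>] 0) :=
  tendsto_inv_atTop_nhdsGT_zero.comp
    (tendsto_atTop_add_const_right _ (-v) tendsto_inv_nhdsGT_zero)

theorem tendsto_integral_rpow_mul_exp_div {α y L : ℝ} (γ : ℝ) (hα : 0 < α) (hy : 0 < y)
    {g : ℝ → ℝ} (hg : Measurable g) (hg1 : ∀ t, |g t| ≤ 1)
    (hgL : Tendsto g (𝓝[>] 0) (𝓝 L)) :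
    Tendsto (fun u : ℝ => 1 / (u ^ γ * Real.exp (α / u)) *
        ∫ t in u..y, t ^ (γ - 2) * Real.exp (α / t) * g t) (𝓝[>] 0) (𝓝 (L / α)) := by
  obtain ⟨C, hC⟩ := one_add_mul_rpow_le hy (half_pos hα) |γ| (abs_nonneg γ)
  have hlim : ∫ v in Ioi (0 : ℝ), Real.exp (-α * v) * L = L / α := by
    rw [integral_mul_const, integral_exp_mul_Ioi (by linarith)]
    simp
    ring
  have hev : ∀ᶠ u : ℝ in 𝓝[>] 0, 0 < u ∧ u < y := Ioo_mem_nhdsGT hy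
  rw [← hlim]
  have key : Tendsto (fun u : ℝ => ∫ v in Ioi (0 : ℝ), (Ioc 0 (u⁻¹ - y⁻¹)).indicator
      (fun v => ((u⁻¹ - v)⁻¹ / u) ^ γ * Real.exp (-α * v) * g (u⁻¹ - v)⁻¹) v)
      (𝓝[>] 0) (𝓝 (∫ v in Ioi (0 : ℝ), Real.exp (-α * v) * L)) := by
    refine tendsto_integral_filter_of_dominated_convergence
      (fun v => C * Real.exp (-(α / 2) * v)) ?_ ?_ ?_ ?_
    · refine Eventually.of_forall fun u => ?_
      exact (Measurable.indicator (by fun_prop) measurableSet_Ioc).aestronglyMeasurable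
    · filter_upwards [hev] with u ⟨hu, huy⟩
      filter_upwards [ae_restrict_mem measurableSet_Ioi] with v hv
      have hv : 0 < v := hv
      by_cases hmem : v ∈ Ioc 0 (u⁻¹ - y⁻¹)
      · rw [indicator_of_mem hmem]
        have hψmem : (u⁻¹ - v)⁻¹ ∈ Ioc u y := by
          rw [← image_inv_sub_Ioc hu huy]
          exact ⟨v, hmem, rfl⟩
        have hw : 0 < u⁻¹ - v := by linarith [hmem.2, inv_pos.2 hy]
        have hr : (u⁻¹ - v)⁻¹ / u = 1 + (u⁻¹ - v)⁻¹ * v := by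
          have := inv_mul_cancel₀ hw.ne'
          rw [div_eq_mul_inv]
          linear_combination this
        have hr1 : 1 ≤ (u⁻¹ - v)⁻¹ / u := (one_le_div hu).2 hψmem.1.le
        have hr2 : (u⁻¹ - v)⁻¹ / u ≤ 1 + y * v := by
          rw [hr]
          gcongr
          exact hψmem.2
        have hb : ((u⁻¹ - v)⁻¹ / u) ^ γ ≤ C * Real.exp (α / 2 * v) :=
          calc ((u⁻¹ - v)⁻¹ / u) ^ γ ≤ ((u⁻¹ - v)⁻¹ / u) ^ |γ| :=
                Real.rpow_le_rpow_of_exponent_le hr1 (le_abs_self γ)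
            _ ≤ (1 + y * v) ^ |γ| :=
                Real.rpow_le_rpow (by linarith) hr2 (abs_nonneg γ)
            _ ≤ _ := hC v hv.le
        have hb0 : 0 ≤ ((u⁻¹ - v)⁻¹ / u) ^ γ := Real.rpow_nonneg (by linarith) _
        rw [Real.norm_eq_abs, abs_mul, abs_mul, abs_of_nonneg hb0, Real.abs_exp]
        calc ((u⁻¹ - v)⁻¹ / u) ^ γ * Real.exp (-α * v) * |g (u⁻¹ - v)⁻¹|
            ≤ (C * Real.exp (α / 2 * v)) * Real.exp (-α * v) * 1 := by
              have := hb0.trans hb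
              gcongr
              exact hg1 _
          _ = C * Real.exp (-(α / 2) * v) := by
              rw [mul_one, mul_assoc, ← Real.exp_add]
              ring_nf
      · rw [indicator_of_notMem hmem, norm_zero]
        have hC0 : 0 ≤ C := by
          have := hC 0 le_rfl
          norm_num at this
          linarith
        positivity
    · exact (integrableOn_exp_mul_Ioi (by linarith) 0).const_mul C
    · filter_upwards [ae_restrict_mem measurableSet_Ioi] with v hv
      have hmem : ∀ᶠ u : ℝ in 𝓝[>] 0, v ∈ Ioc 0 (u⁻¹ - y⁻¹) := by
        filter_upwards [tendsto_inv_nhdsGT_zero.eventually_ge_atTop (v + y⁻¹)] with u hu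
        exact ⟨hv, by linarith⟩
      have hratio : Tendsto (fun u : ℝ => (u⁻¹ - v)⁻¹ / u) (𝓝[>] 0) (𝓝 1) := by
        have h : Tendsto (fun u : ℝ => (1 - u * v)⁻¹) (𝓝[>] 0) (𝓝 1) := by
          have : ContinuousAt (fun u : ℝ => (1 - u * v)⁻¹) 0 :=
            ContinuousAt.inv₀ (by fun_prop) (by simp)
          simpa [ContinuousAt] using this.tendsto.mono_left nhdsWithin_le_nhds
        refine h.congr' ?_
        filter_upwards [self_mem_nhdsWithin] with u hu
        have hu : u ≠ 0 := (mem_Ioi.1 hu).ne'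
        rw [div_eq_mul_inv, ← mul_inv, sub_mul, inv_mul_cancel₀ hu, mul_comm v]
      have hpow := hratio.rpow_const (p := γ) (Or.inl one_ne_zero)
      rw [Real.one_rpow] at hpow
      have := (hpow.mul_const (Real.exp (-α * v))).mul (hgL.comp (tendsto_inv_inv_sub v))
      rw [one_mul] at this
      refine this.congr' ?_
      filter_upwards [hmem] with u hu
      rw [indicator_of_mem hu]
      rfl
  refine key.congr' ?_
  filter_upwards [hev] with u ⟨hu, huy⟩
  rw [integral_rpow_mul_exp_div_eq hu huy, setIntegral_indicator measurableSet_Ioc,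
    inter_eq_right.2 Ioc_subset_Ioi_self]

theorem stmt12
    (Fbar : ℝ → ℝ) (μ α γ m : ℝ)
    (hμ : 0 < μ) (hα : 0 < α)
    (hF_anti : AntitoneOn Fbar (Set.Ici 0))
    (hF_mem : ∀ y ∈ Set.Ici (0 : ℝ), Fbar y ∈ Set.Icc (0 : ℝ) 1)
    (hF_int : IntegrableOn Fbar (Set.Ioi 0))
    (hm : m = ∫ z in Set.Ioi (0 : ℝ), Fbar z)
    (u₀ : ℝ) (hu₀ : 0 < u₀) :
    ∀ y ∈ Set.Ioc (0 : ℝ) u₀,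
      Tendsto (fun u : ℝ => μ / (u ^ γ * Real.exp (α / u)) *
          ∫ t in u..y, t ^ (γ - 2) * Real.exp (α / t) * Fbar (y - t))
        (nhdsWithin 0 (Set.Ioi 0)) (nhds (μ / α * leftLim Fbar y)) := by
  rintro y ⟨hy, -⟩
  set G : ℝ → ℝ := fun z => Fbar (max z 0) with hG
  have hGanti : Antitone G := fun a b hab =>
    hF_anti (le_max_right a 0) (le_max_right b 0) (max_le_max_right 0 hab)
  have hGeq : ∀ z, 0 ≤ z → G z = Fbar z := fun z hz => by simp [hG, max_eq_left hz]
  have hleft : leftLim Fbar y = leftLim G y := by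
    refine leftLim_eq_of_tendsto ((hGanti.tendsto_leftLim y).congr' ?_)
    filter_upwards [Ioo_mem_nhdsLT hy] with z hz using hGeq z hz.1.le
  have hsub : Tendsto (fun t : ℝ => y - t) (𝓝[>] 0) (𝓝[<] y) := by
    refine tendsto_nhdsWithin_iff.2 ⟨?_, ?_⟩
    · have : ContinuousAt (fun t : ℝ => y - t) 0 := by fun_prop
      simpa [ContinuousAt] using this.tendsto.mono_left nhdsWithin_le_nhds
    · filter_upwards [self_mem_nhdsWithin] with t ht
      exact sub_lt_self y ht
  have main := (tendsto_integral_rpow_mul_exp_div γ hα hy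
    (g := fun t => G (y - t)) (hGanti.measurable.comp (by fun_prop))
    (fun t => by
      have := hF_mem (max (y - t) 0) (mem_Ici.2 (le_max_right _ _))
      exact abs_le.2 ⟨by linarith [this.1], this.2⟩)
    ((hGanti.tendsto_leftLim y).comp hsub)).const_mul μ
  rw [hleft, div_mul_eq_mul_div, mul_div_assoc]
  refine main.congr' ?_
  filter_upwards [Ioo_mem_nhdsGT hy] with u hu
  rw [← mul_assoc, mul_one_div]
  congr 1
  refine intervalIntegral.integral_congr fun t ht => ?_
  rw [uIcc_of_le hu.2.le] at ht
  simp only [hGeq (y - t) (sub_nonneg.2 ht.2)]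
end
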